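/- arXiv:1705.10434 — 6 statements merged into one kernel-verified Lean document; each statement's English description precedes it below -/
import Mathlib

section
/- Let 0 ≤ R < 1 and let c : [R,1] → (0,∞) be C^{1,1} and satisfy the Herglotz condition. Then the functions α and L are continuously differentiable on the open interval (R,1). -/
/-- `c` is `C^{1,1}` on `[R,1]`: differentiable with Lipschitz derivative. -/
def IsC11On (c : ℝ → ℝ) (R : ℝ) : Prop :=
  ∃ c' : ℝ → ℝ, ∃ K : NNReal,
    (∀ r ∈ Set.Icc R 1, HasDerivWithinAt c (c' r) (Set.Icc R 1) r) ∧
    LipschitzOnWith K c' (Set.Icc R 1)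

/-- The Herglotz condition: `d/dr (r / c r) > 0` on `[R,1]`. -/
def HerglotzCond (c : ℝ → ℝ) (R : ℝ) : Prop :=
  ∀ r ∈ Set.Icc R 1, 0 < derivWithin (fun s => s / c s) (Set.Icc R 1) r

/-- Half length `L(r)` of the maximal geodesic of radius `r`. -/
noncomputable def Lfun (c : ℝ → ℝ) (r : ℝ) : ℝ :=
  ∫ s in r..1, (c s)⁻¹ * (Real.sqrt (1 - (r * c s / (s * c r)) ^ 2))⁻¹

/-- Half of the angular distance `α(r)` between the endpoints of the maximal geodesic
of radius `r`. -/
noncomputable def alphaFun (c : ℝ → ℝ) (r : ℝ) : ℝ :=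
  ∫ s in r..1, (r * c s) / (c r * s ^ 2) * (Real.sqrt (1 - (r * c s / (s * c r)) ^ 2))⁻¹

open MeasureTheory Set Filter Topology

theorem key_aux (a b : ℝ) (ha : 0 ≤ a) (hb : b < 1)
    (p p' g g' : ℝ → ℝ) (m M K : ℝ) (hm : 0 < m) (hM : 0 ≤ M) (hK : 0 ≤ K)
    (hp : ∀ s ∈ Ioo a 1, HasDerivAt p (p' s) s)
    (hpm : ∀ s ∈ Ioo a 1, m ≤ p' s)
    (hpM : ∀ s ∈ Ioo a 1, |p' s| ≤ M)
    (hpK : ∀ s ∈ Ioo a 1, ∀ t ∈ Ioo a 1, |p' s - p' t| ≤ K * |s - t|)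
    (hpc : ContinuousOn p' (Ioo a 1))
    (hg : ∀ s ∈ Ioo a 1, HasDerivAt g (g' s) s)
    (hgM : ∀ s ∈ Ioo a 1, |g s| ≤ M)
    (hgM' : ∀ s ∈ Ioo a 1, |g' s| ≤ M)
    (hgc : ContinuousOn g' (Ioo a 1)) :
    ContDiffOn ℝ 1 (fun r => ∫ s in r..1, g s / √(p s - p r)) (Ioo a b) := by
  have hS : ∀ r ∈ Ioo a b, ∀ t ∈ Ioo (0:ℝ) 1, r + (1 - r) * t ∈ Ioo a 1 ∧ r ∈ Ioo a 1 := by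
    rintro r ⟨h1, h2⟩ t ⟨h3, h4⟩
    refine ⟨⟨?_, ?_⟩, h1, by linarith⟩
    · nlinarith [mul_pos (by linarith : 0 < 1 - r) h3]
    · nlinarith [mul_pos (by linarith : 0 < 1 - r) (by linarith : 0 < 1 - t)]
  set k := m * (1 - b) with hk
  have hkpos : 0 < k := mul_pos hm (by linarith)
  have hD : ∀ r ∈ Ioo a b, ∀ t ∈ Ioo (0:ℝ) 1, k * t ≤ p (r + (1 - r) * t) - p r := by
    intro r hr t ht
    obtain ⟨h1, h2⟩ := hS r hr t ht
    have hlt : 0 < (1 - r) * t := mul_pos (by linarith [hr.2]) ht.1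
    have := (convex_Ioo a 1).mul_sub_le_image_sub_of_le_deriv (f := p) (C := m)
      (fun x hx => (hp x hx).continuousAt.continuousWithinAt)
      (by rw [interior_Ioo]; exact fun x hx => (hp x hx).differentiableAt.differentiableWithinAt)
      (by rw [interior_Ioo]; intro x hx; rw [(hp x hx).deriv]; exact hpm x hx)
      r h2 (r + (1 - r) * t) h1 (by linarith)
    have h3 : (1 - b) * t ≤ (1 - r) * t := by
      have := hr.2
      have := ht.1
      gcongr
    calc k * t = m * ((1 - b) * t) := by rw [hk]; ring
      _ ≤ m * ((1 - r) * t) := by gcongr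
      _ = m * (r + (1 - r) * t - r) := by ring
      _ ≤ _ := this
  have hDpos : ∀ r ∈ Ioo a b, ∀ t ∈ Ioo (0:ℝ) 1, 0 < p (r + (1 - r) * t) - p r :=
    fun r hr t ht => (mul_pos hkpos ht.1).trans_le (hD r hr t ht)
  let D : ℝ → ℝ → ℝ := fun r t => p (r + (1 - r) * t) - p r
  let E : ℝ → ℝ → ℝ := fun r t => p' (r + (1 - r) * t) * (1 - t) - p' r
  let H : ℝ → ℝ → ℝ := fun r t => (1 - r) * (g (r + (1 - r) * t) / √(D r t))
  let H' : ℝ → ℝ → ℝ := fun r t => (√(D r t))⁻¹ *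
    (- g (r + (1 - r) * t) + (1 - r) * (1 - t) * g' (r + (1 - r) * t)
      - (1 - r) * g (r + (1 - r) * t) * (E r t / D r t) / 2)
  have hDt : ∀ r ∈ Ioo a b, ContinuousOn (fun t => √(D r t)) (Ioo 0 1) := by
    intro r hr
    apply ContinuousOn.sqrt
    apply ContinuousOn.sub _ continuousOn_const
    intro t ht
    exact ((hp _ (hS r hr t ht).1).continuousAt.comp (f := fun t => r + (1 - r) * t) (x := t)
      (by fun_prop)).continuousWithinAt
  have hgt : ∀ r ∈ Ioo a b, ContinuousOn (fun t => g (r + (1 - r) * t)) (Ioo 0 1) := by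
    intro r hr t ht
    exact ((hg _ (hS r hr t ht).1).continuousAt.comp (f := fun t => r + (1 - r) * t) (x := t)
      (by fun_prop)).continuousWithinAt
  have cA : ∀ f : ℝ → ℝ, ContinuousOn f (Ioo a 1) → ∀ s ∈ Ioo a 1, ContinuousAt f s :=
    fun f hf s hs => hf.continuousAt (isOpen_Ioo.mem_nhds hs)
  have hg't : ∀ r ∈ Ioo a b, ContinuousOn (fun t => g' (r + (1 - r) * t)) (Ioo 0 1) := by
    intro r hr t ht
    exact ((cA _ hgc _ (hS r hr t ht).1).comp (f := fun t => r + (1 - r) * t) (x := t)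
      (by fun_prop)).continuousWithinAt
  have hp't : ∀ r ∈ Ioo a b, ContinuousOn (fun t => p' (r + (1 - r) * t)) (Ioo 0 1) := by
    intro r hr t ht
    exact ((cA _ hpc _ (hS r hr t ht).1).comp (f := fun t => r + (1 - r) * t) (x := t)
      (by fun_prop)).continuousWithinAt
  have hDt2 : ∀ r ∈ Ioo a b, ContinuousOn (fun t => D r t) (Ioo 0 1) := by
    intro r hr
    apply ContinuousOn.sub _ continuousOn_const
    intro t ht
    exact ((hp _ (hS r hr t ht).1).continuousAt.comp (f := fun t => r + (1 - r) * t) (x := t)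
      (by fun_prop)).continuousWithinAt
  have hHm : ∀ r ∈ Ioo a b, ContinuousOn (H r) (Ioo 0 1) := by
    intro r hr
    exact continuousOn_const.mul ((hgt r hr).div (hDt r hr)
      (fun t ht => (Real.sqrt_pos.2 (hDpos r hr t ht)).ne'))
  have hHm' : ∀ r ∈ Ioo a b, ContinuousOn (H' r) (Ioo 0 1) := by
    intro r hr
    have h1 := (hDt r hr).inv₀ (fun t ht => (Real.sqrt_pos.2 (hDpos r hr t ht)).ne')
    have h2 : ContinuousOn (fun t => E r t / D r t) (Ioo 0 1) := by
      apply ContinuousOn.div _ (hDt2 r hr) (fun t ht => (hDpos r hr t ht).ne')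
      exact ((hp't r hr).mul (by fun_prop)).sub continuousOn_const
    have h3 := hgt r hr
    have h4 := hg't r hr
    have h5 : ContinuousOn (fun t : ℝ => (1 - r) * (1 - t)) (Ioo 0 1) := by fun_prop
    exact h1.mul ((h3.neg.add (h5.mul h4)).sub (((continuousOn_const.mul h3).mul h2).div_const 2))
  have hder : ∀ r ∈ Ioo a b, ∀ t ∈ Ioo (0:ℝ) 1, HasDerivAt (fun r => H r t) (H' r t) r := by
    intro r hr t ht
    obtain ⟨h1, h2⟩ := hS r hr t ht
    have hpos := hDpos r hr t ht
    have hs : HasDerivAt (fun r : ℝ => r + (1 - r) * t) (1 - t) r := by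
      have := (hasDerivAt_id r).add (((hasDerivAt_id r).const_sub 1).mul_const t)
      refine HasDerivAt.congr_deriv this ?_
      ring
    have hP : HasDerivAt (fun r => D r t) (E r t) r :=
      (HasDerivAt.comp r (hp _ h1) hs).sub (hp r h2)
    have hG : HasDerivAt (fun r => g (r + (1 - r) * t)) (g' (r + (1 - r) * t) * (1 - t)) r :=
      HasDerivAt.comp r (hg _ h1) hs
    have hsq := hP.sqrt hpos.ne'
    have hsp : 0 < √(D r t) := Real.sqrt_pos.2 hpos
    have := ((hasDerivAt_id r).const_sub 1).mul (hG.div hsq hsp.ne')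
    refine HasDerivAt.congr_deriv this ?_
    have hss : D r t = √(D r t) ^ 2 := (Real.sq_sqrt hpos.le).symm
    simp only [H', id, Pi.div_apply]
    have hq : E r t / D r t = E r t / √(D r t) ^ 2 := by rw [← hss]
    rw [hq]
    field_simp
    ring
  set C : ℝ := M + M + M * ((K + M) / k) / 2 with hC
  have hC0 : 0 ≤ C := by positivity
  have hsqb : ∀ r ∈ Ioo a b, ∀ t ∈ Ioo (0:ℝ) 1, (√(D r t))⁻¹ ≤ (√k)⁻¹ * t ^ (-(1/2) : ℝ) := by
    intro r hr t ht
    rw [Real.rpow_neg ht.1.le, ← Real.sqrt_eq_rpow, ← mul_inv, ← Real.sqrt_mul hkpos.le]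
    have := mul_pos hkpos ht.1
    have := hD r hr t ht
    gcongr
  have hbd : ∀ r ∈ Ioo a b, ∀ t ∈ Ioo (0:ℝ) 1, ‖H' r t‖ ≤ (√k)⁻¹ * t ^ (-(1/2) : ℝ) * C := by
    intro r hr t ht
    obtain ⟨h1, h2⟩ := hS r hr t ht
    have hpos : 0 < D r t := hDpos r hr t ht
    have hr1 : |1 - r| ≤ 1 := abs_le.2 ⟨by linarith [h2.2], by linarith [h2.1]⟩
    have ht1 : |1 - t| ≤ 1 := abs_le.2 ⟨by linarith [ht.2], by linarith [ht.1]⟩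
    have hE : |E r t| ≤ (K + M) * t := by
      have e : E r t = (p' (r + (1 - r) * t) - p' r) - t * p' (r + (1 - r) * t) := by
        simp only [E]; ring
      rw [e]
      refine (abs_sub _ _).trans ?_
      have i1 := hpK _ h1 r h2
      have i2 := hpM _ h1
      have i3 : |r + (1 - r) * t - r| ≤ t := by
        rw [show r + (1 - r) * t - r = (1 - r) * t by ring, abs_mul, abs_of_pos ht.1]
        nlinarith [ht.1]
      rw [abs_mul, abs_of_pos ht.1]
      nlinarith [ht.1, mul_le_mul_of_nonneg_left i3 hK, mul_le_mul_of_nonneg_left i2 ht.1.le]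
    have hED : |E r t / D r t| ≤ (K + M) / k := by
      rw [abs_div, abs_of_pos hpos, div_le_div_iff₀ hpos hkpos]
      calc |E r t| * k ≤ (K + M) * t * k := by gcongr
        _ = (K + M) * (k * t) := by ring
        _ ≤ _ := by
          have := hD r hr t ht
          gcongr
    rw [Real.norm_eq_abs, abs_mul, abs_of_nonneg (inv_nonneg.2 (Real.sqrt_nonneg _))]
    have hgb := hgM _ h1
    have hgb' := hgM' _ h1
    have tot : |- g (r + (1 - r) * t) + (1 - r) * (1 - t) * g' (r + (1 - r) * t)
      - (1 - r) * g (r + (1 - r) * t) * (E r t / D r t) / 2| ≤ C := by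
      refine (abs_sub _ _).trans ?_
      rw [hC]
      refine add_le_add ((abs_add_le _ _).trans (add_le_add ?_ ?_)) ?_
      · rwa [abs_neg]
      · rw [abs_mul, abs_mul]
        calc _ ≤ 1 * 1 * M := by gcongr
          _ = M := by ring
      · rw [abs_div, abs_mul, abs_mul, abs_two]
        calc _ ≤ 1 * M * ((K + M) / k) / 2 := by gcongr
          _ = _ := by ring
    have := hsqb r hr t ht
    gcongr
    exact mul_nonneg (by positivity) (Real.rpow_nonneg ht.1.le _)
  have hint : IntegrableOn (fun t : ℝ => (√k)⁻¹ * t ^ (-(1/2) : ℝ)) (Ioo 0 1) := by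
    have := (intervalIntegral.intervalIntegrable_rpow' (a := 0) (b := 1) (r := -(1/2)) (by norm_num))
    rw [intervalIntegrable_iff_integrableOn_Ioo_of_le zero_le_one] at this
    exact this.const_mul _
  have hHint : ∀ r ∈ Ioo a b, IntegrableOn (H r) (Ioo 0 1) := by
    intro r hr
    refine Integrable.mono' (hint.mul_const M) ((hHm r hr).aestronglyMeasurable measurableSet_Ioo) ?_
    refine (ae_restrict_iff' measurableSet_Ioo).2 (Eventually.of_forall fun t ht => ?_)
    obtain ⟨h1, h2⟩ := hS r hr t ht
    have hr1 : |1 - r| ≤ 1 := abs_le.2 ⟨by linarith [h2.2], by linarith [h2.1]⟩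
    have hgb := hgM _ h1
    have := hsqb r hr t ht
    have h5 := inv_nonneg.2 (Real.sqrt_nonneg (D r t))
    simp only [H]
    rw [Real.norm_eq_abs, abs_mul, div_eq_mul_inv, abs_mul, abs_of_nonneg h5]
    calc _ ≤ 1 * (M * ((√k)⁻¹ * t ^ (-(1/2) : ℝ))) := by gcongr
      _ = _ := by ring
  have hF : ∀ r ∈ Ioo a b, HasDerivAt (fun r => ∫ t in Ioo (0:ℝ) 1, H r t)
      (∫ t in Ioo (0:ℝ) 1, H' r t) r := by
    intro r hr
    have hn : Ioo a b ∈ 𝓝 r := isOpen_Ioo.mem_nhds hr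
    refine (hasDerivAt_integral_of_dominated_loc_of_deriv_le (F := H) (F' := H')
      (bound := fun t => (√k)⁻¹ * t ^ (-(1/2) : ℝ) * C) hn ?_ (hHint r hr)
      ((hHm' r hr).aestronglyMeasurable measurableSet_Ioo) ?_ (hint.mul_const C) ?_).2
    · filter_upwards [hn] with x hx
      exact (hHm x hx).aestronglyMeasurable measurableSet_Ioo
    · exact (ae_restrict_iff' measurableSet_Ioo).2
        (Eventually.of_forall fun t ht x hx => hbd x hx t ht)
    · exact (ae_restrict_iff' measurableSet_Ioo).2
        (Eventually.of_forall fun t ht x hx => hder x hx t ht)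
  have hcont : ContinuousOn (fun r => ∫ t in Ioo (0:ℝ) 1, H' r t) (Ioo a b) := by
    intro r hr
    have hn : Ioo a b ∈ 𝓝 r := isOpen_Ioo.mem_nhds hr
    apply ContinuousAt.continuousWithinAt
    refine continuousAt_of_dominated (bound := fun t => (√k)⁻¹ * t ^ (-(1/2) : ℝ) * C)
      ?_ ?_ (hint.mul_const C) ?_
    · filter_upwards [hn] with x hx
      exact (hHm' x hx).aestronglyMeasurable measurableSet_Ioo
    · filter_upwards [hn] with x hx
      exact (ae_restrict_iff' measurableSet_Ioo).2
        (Eventually.of_forall fun t ht => hbd x hx t ht)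
    · refine (ae_restrict_iff' measurableSet_Ioo).2 (Eventually.of_forall fun t ht => ?_)
      obtain ⟨h1, h2⟩ := hS r hr t ht
      have cs : ContinuousAt (fun r : ℝ => r + (1 - r) * t) r := by fun_prop
      have c1 : ContinuousAt (fun r => g (r + (1 - r) * t)) r :=
        ContinuousAt.comp (f := fun r : ℝ => r + (1 - r) * t) (hg _ h1).continuousAt cs
      have c2 : ContinuousAt (fun r => g' (r + (1 - r) * t)) r :=
        ContinuousAt.comp (f := fun r : ℝ => r + (1 - r) * t) (cA _ hgc _ h1) cs
      have c3 : ContinuousAt (fun r => p' (r + (1 - r) * t)) r :=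
        ContinuousAt.comp (f := fun r : ℝ => r + (1 - r) * t) (cA _ hpc _ h1) cs
      have c4 : ContinuousAt (fun r => p (r + (1 - r) * t)) r :=
        ContinuousAt.comp (f := fun r : ℝ => r + (1 - r) * t) (hp _ h1).continuousAt cs
      have c5 : ContinuousAt (fun r => D r t) r := c4.sub (hp r h2).continuousAt
      have c6 : ContinuousAt (fun r => E r t) r :=
        (c3.mul continuousAt_const).sub (cA _ hpc _ h2)
      have hpos := hDpos r hr t ht
      have c7 := c6.div c5 hpos.ne'
      have c8 := c5.sqrt.inv₀ (Real.sqrt_pos.2 hpos).ne'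
      have c9 : ContinuousAt (fun r : ℝ => 1 - r) r := by fun_prop
      exact c8.mul ((c1.neg.add ((c9.mul continuousAt_const).mul c2)).sub
        (((c9.mul c1).mul c7).div_const 2))
  have hmain : ContDiffOn ℝ 1 (fun r => ∫ t in Ioo (0:ℝ) 1, H r t) (Ioo a b) := by
    have := (contDiffOn_succ_iff_deriv_of_isOpen (𝕜 := ℝ) (n := 0)
      (f := fun r => ∫ t in Ioo (0:ℝ) 1, H r t) (isOpen_Ioo (a := a) (b := b))).2
      ⟨fun r hr => (hF r hr).differentiableAt.differentiableWithinAt, by simp, by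
        rw [contDiffOn_zero]
        exact hcont.congr fun r hr => (hF r hr).deriv⟩
    simpa using this
  refine hmain.congr fun r hr => ?_
  have := intervalIntegral.smul_integral_comp_add_mul (a := 0) (b := 1)
    (fun s => g s / √(p s - p r)) (1 - r) r
  simp only [mul_zero, mul_one, add_zero, add_sub_cancel, smul_eq_mul] at this
  rw [← this, ← intervalIntegral.integral_const_mul, intervalIntegral.integral_of_le zero_le_one,
    integral_Ioc_eq_integral_Ioo]

/-- Bounded and Lipschitz on a set. -/
def LBOn (f : ℝ → ℝ) (S : Set ℝ) : Prop :=
  ∃ C : ℝ, 0 ≤ C ∧ (∀ x ∈ S, |f x| ≤ C) ∧ ∀ x ∈ S, ∀ y ∈ S, |f x - f y| ≤ C * |x - y|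

theorem LBOn.sub {f g : ℝ → ℝ} {S : Set ℝ} (hf : LBOn f S) (hg : LBOn g S) :
    LBOn (fun x => f x - g x) S := by
  obtain ⟨C, hC, h1, h2⟩ := hf
  obtain ⟨C', hC', h1', h2'⟩ := hg
  refine ⟨C + C', by positivity, fun x hx => (abs_sub _ _).trans (add_le_add (h1 x hx) (h1' x hx)),
    fun x hx y hy => ?_⟩
  rw [show f x - g x - (f y - g y) = (f x - f y) - (g x - g y) by ring, add_mul]
  exact (abs_sub _ _).trans (add_le_add (h2 x hx y hy) (h2' x hx y hy))

theorem LBOn.mul {f g : ℝ → ℝ} {S : Set ℝ} (hf : LBOn f S) (hg : LBOn g S) :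
    LBOn (fun x => f x * g x) S := by
  obtain ⟨C, hC, h1, h2⟩ := hf
  obtain ⟨C', hC', h1', h2'⟩ := hg
  refine ⟨2 * (C * C'), by positivity, fun x hx => ?_, fun x hx y hy => ?_⟩
  · rw [abs_mul]
    have := mul_le_mul (h1 x hx) (h1' x hx) (abs_nonneg _) hC
    nlinarith [mul_nonneg hC hC']
  · rw [show f x * g x - f y * g y = f x * (g x - g y) + (f x - f y) * g y by ring]
    refine (abs_add_le _ _).trans ?_
    rw [abs_mul, abs_mul]
    have e1 := mul_le_mul (h1 x hx) (h2' x hx y hy) (abs_nonneg _) hC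
    have e2 := mul_le_mul (h2 x hx y hy) (h1' y hy) (abs_nonneg _)
      (mul_nonneg hC (abs_nonneg _))
    linarith

theorem LBOn.inv {f : ℝ → ℝ} {S : Set ℝ} (hf : LBOn f S) {m : ℝ} (hm : 0 < m)
    (hfm : ∀ x ∈ S, m ≤ f x) : LBOn (fun x => (f x)⁻¹) S := by
  obtain ⟨C, hC, h1, h2⟩ := hf
  refine ⟨m⁻¹ + C * (m⁻¹ * m⁻¹), by positivity, fun x hx => ?_, fun x hx y hy => ?_⟩
  · have := hfm x hx
    have hx0 : 0 < f x := hm.trans_le this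
    rw [abs_of_pos (inv_pos.2 hx0)]
    have e : (f x)⁻¹ ≤ m⁻¹ := by gcongr
    have : 0 ≤ C * (m⁻¹ * m⁻¹) := by positivity
    linarith
  · have hx0 : 0 < f x := hm.trans_le (hfm x hx)
    have hy0 : 0 < f y := hm.trans_le (hfm y hy)
    have e : (f x)⁻¹ - (f y)⁻¹ = -(f x - f y) * ((f x)⁻¹ * (f y)⁻¹) := by field_simp; ring
    rw [e, abs_mul, abs_neg, abs_of_pos (mul_pos (inv_pos.2 hx0) (inv_pos.2 hy0))]
    have e1 : (f x)⁻¹ ≤ m⁻¹ := by have := hfm x hx; gcongr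
    have e2 : (f y)⁻¹ ≤ m⁻¹ := by have := hfm y hy; gcongr
    have e3 := h2 x hx y hy
    calc _ ≤ C * |x - y| * (m⁻¹ * m⁻¹) := by gcongr
      _ ≤ _ := by
        have : 0 ≤ m⁻¹ * |x - y| := by positivity
        linarith

theorem LBOn.continuousOn {f : ℝ → ℝ} {S : Set ℝ} (hf : LBOn f S) : ContinuousOn f S := by
  obtain ⟨C, hC, -, h2⟩ := hf
  refine (LipschitzOnWith.of_dist_le_mul (K := ⟨C, hC⟩) fun x hx y hy => ?_).continuousOn
  exact h2 x hx y hy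

theorem key_C (a b : ℝ) (ha : 0 ≤ a) (hb : b < 1) (ha1 : a < 1)
    (p p' g g' : ℝ → ℝ)
    (hp : ∀ s ∈ Ioo a 1, HasDerivAt p (p' s) s)
    (hpm : ∀ s ∈ Icc a 1, 0 < p' s)
    (hpL : LBOn p' (Icc a 1))
    (hg : ∀ s ∈ Ioo a 1, HasDerivAt g (g' s) s)
    (hgc0 : ContinuousOn g (Icc a 1))
    (hgc : ContinuousOn g' (Icc a 1)) :
    ContDiffOn ℝ 1 (fun r => ∫ s in r..1, g s / √(p s - p r)) (Ioo a b) := by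
  have hne : (Icc a 1).Nonempty := nonempty_Icc.2 ha1.le
  have hpc := hpL.continuousOn
  obtain ⟨x, hx, hxm⟩ := isCompact_Icc.exists_isMinOn hne hpc
  obtain ⟨K, hK, h1, h2⟩ := hpL
  obtain ⟨M1, hM1⟩ := isCompact_Icc.exists_bound_of_continuousOn hgc0
  obtain ⟨M2, hM2⟩ := isCompact_Icc.exists_bound_of_continuousOn hgc
  have hsub : Ioo a 1 ⊆ Icc a 1 := Ioo_subset_Icc_self
  have hl : K ≤ max K (max M1 M2) := le_max_left _ _
  have hl1 : M1 ≤ max K (max M1 M2) := (le_max_left _ _).trans (le_max_right _ _)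
  have hl2 : M2 ≤ max K (max M1 M2) := (le_max_right _ _).trans (le_max_right _ _)
  exact key_aux a b ha hb p p' g g' (p' x) (max K (max M1 M2)) K (hpm x hx) (hK.trans hl) hK hp
    (fun s hs => hxm (hsub hs)) (fun s hs => (h1 s (hsub hs)).trans hl)
    (fun s hs t ht => h2 s (hsub hs) t (hsub ht)) (hpc.mono hsub) hg
    (fun s hs => (hM1 s (hsub hs)).trans hl1) (fun s hs => (hM2 s (hsub hs)).trans hl2)
    (hgc.mono hsub)

theorem local_main (R : ℝ) (hR0 : 0 ≤ R) (c : ℝ → ℝ)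
    (hpos : ∀ r ∈ Set.Icc R 1, 0 < c r)
    (hC11 : IsC11On c R) (hHerg : HerglotzCond c R) (a b : ℝ) (hRa : R < a) (hb : b < 1)
    (ha1 : a < 1) :
    ContDiffOn ℝ 1 (alphaFun c) (Set.Ioo a b) ∧ ContDiffOn ℝ 1 (Lfun c) (Set.Ioo a b) := by
  obtain ⟨c', K, hc, hK⟩ := hC11
  have hR1 : R < 1 := hRa.trans ha1
  have ha : 0 < a := hR0.trans_lt hRa
  have hsub : Icc a 1 ⊆ Icc R 1 := Icc_subset_Icc_left hRa.le
  have hcpos : ∀ s ∈ Icc a 1, 0 < c s := fun s hs => hpos s (hsub hs)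
  have hspos : ∀ s ∈ Icc a 1, 0 < s := fun s hs => ha.trans_le hs.1
  have hcA : ∀ s ∈ Ioo a 1, HasDerivAt c (c' s) s := fun s hs =>
    (hc s (hsub (Ioo_subset_Icc_self hs))).hasDerivAt
      (Icc_mem_nhds (hRa.trans hs.1) hs.2)
  have hnum : ∀ s ∈ Icc a 1, 0 < c s - s * c' s := by
    intro s hs
    have hs' := hsub hs
    have h1 := (hasDerivWithinAt_id s (Icc R 1)).div (hc s hs') (hpos s hs').ne'
    have h2 := hHerg s hs'
    have h3 := h1.derivWithin (uniqueDiffOn_Icc hR1 s hs')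
    have h4 : derivWithin (fun s => s / c s) (Icc R 1) s =
      (1 * c s - id s * c' s) / c s ^ 2 := h3
    rw [h4] at h2
    have h5 := hpos s hs'
    have h6 : 0 < c s ^ 2 := by positivity
    have := (div_pos_iff_of_pos_right h6).1 h2
    simpa using this
  have hcc : ContinuousOn c (Icc a 1) := fun s hs => ((hc s (hsub hs)).continuousWithinAt).mono hsub
  have hcc' : ContinuousOn c' (Icc a 1) := hK.continuousOn.mono hsub
  have hne : (Icc a 1).Nonempty := nonempty_Icc.2 ha1.le
  have LBc' : LBOn c' (Icc a 1) := by
    obtain ⟨M, hM⟩ := isCompact_Icc.exists_bound_of_continuousOn hcc'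
    refine ⟨max K M, K.2.trans (le_max_left _ _), fun x hx => (hM x hx).trans (le_max_right _ _),
      fun x hx y hy => ?_⟩
    have := hK.dist_le_mul x (hsub hx) y (hsub hy)
    rw [Real.dist_eq, Real.dist_eq] at this
    exact this.trans (mul_le_mul_of_nonneg_right (le_max_left _ _) (abs_nonneg _))
  have LBc : LBOn c (Icc a 1) := by
    obtain ⟨M, hM⟩ := isCompact_Icc.exists_bound_of_continuousOn hcc
    obtain ⟨M', hM'⟩ := isCompact_Icc.exists_bound_of_continuousOn hcc'
    refine ⟨max M M', ?_, fun x hx => (hM x hx).trans (le_max_left _ _), fun x hx y hy => ?_⟩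
    · obtain ⟨x, hx⟩ := hne
      exact (norm_nonneg _).trans ((hM x hx).trans (le_max_left _ _))
    · have := (convex_Icc a 1).norm_image_sub_le_of_norm_hasDerivWithin_le
        (fun x hx => (hc x (hsub hx)).mono hsub) hM' hy hx
      rw [Real.norm_eq_abs, Real.norm_eq_abs] at this
      exact this.trans (mul_le_mul_of_nonneg_right (le_max_right _ _) (abs_nonneg _))
  have LBid : LBOn (fun x => x) (Icc a 1) :=
    ⟨1, zero_le_one, fun x hx => abs_le.2 ⟨by linarith [hx.1], hx.2⟩, fun x _ y _ => by simp⟩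
  have LB2 : LBOn (fun _ => 2) (Icc a 1) :=
    ⟨2, zero_le_two, fun x hx => by simp, fun x _ y _ => by simp⟩
  have LBi : LBOn (fun x => (c x)⁻¹) (Icc a 1) := by
    obtain ⟨x, hx, hxm⟩ := isCompact_Icc.exists_isMinOn hne hcc
    exact LBc.inv (hcpos x hx) (fun y hy => hxm hy)
  let p : ℝ → ℝ := fun s => (s / c s) ^ 2
  let p' : ℝ → ℝ := fun s => 2 * (s * (c s - s * c' s)) * ((c s)⁻¹ * ((c s)⁻¹ * (c s)⁻¹))
  have hpL : LBOn p' (Icc a 1) :=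
    (LB2.mul (LBid.mul (LBc.sub (LBid.mul LBc')))).mul (LBi.mul (LBi.mul LBi))
  have hpm : ∀ s ∈ Icc a 1, 0 < p' s := by
    intro s hs
    have := hnum s hs
    have := hspos s hs
    have := hcpos s hs
    positivity
  have hρ : ∀ s ∈ Ioo a 1, HasDerivAt (fun s => s / c s) ((c s - s * c' s) / c s ^ 2) s := by
    intro s hs
    have h0 := hcpos s (Ioo_subset_Icc_self hs)
    have := (hasDerivAt_id s).div (hcA s hs) h0.ne'
    refine HasDerivAt.congr_deriv this ?_
    simp
  have hp : ∀ s ∈ Ioo a 1, HasDerivAt p (p' s) s := by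
    intro s hs
    have h0 := hcpos s (Ioo_subset_Icc_self hs)
    have := (hρ s hs).pow 2
    refine HasDerivAt.congr_deriv this ?_
    norm_num [p']
    field_simp
  have hα := key_C a b ha.le hb ha1 p p' (fun s => s⁻¹) (fun s => -(s ^ 2)⁻¹) hp hpm hpL
    (fun s hs => hasDerivAt_inv (ha.trans hs.1).ne')
    (continuousOn_id.inv₀ fun s hs => (hspos s hs).ne')
    (((continuousOn_id.pow 2).inv₀ fun s hs => (pow_pos (hspos s hs) 2).ne').neg)
  have hL := key_C a b ha.le hb ha1 p p' (fun s => s / c s ^ 2)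
    (fun s => (c s ^ 2 - s * (2 * c s * c' s)) / (c s ^ 2) ^ 2) hp hpm hpL
    (fun s hs => by
      have h0 := hcpos s (Ioo_subset_Icc_self hs)
      have := (hasDerivAt_id s).div ((hcA s hs).pow 2) (pow_pos h0 2).ne'
      refine HasDerivAt.congr_deriv this ?_
      simp)
    (continuousOn_id.div (hcc.pow 2) fun s hs => (pow_pos (hcpos s hs) 2).ne')
    (ContinuousOn.div ((hcc.pow 2).sub (continuousOn_id.mul ((continuousOn_const.mul hcc).mul hcc')))
      ((hcc.pow 2).pow 2) fun s hs => (pow_pos (pow_pos (hcpos s hs) 2) 2).ne')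
  have hρC : ContDiffOn ℝ 1 (fun s => s / c s) (Ioo a b) := by
    have hs1 : Ioo a b ⊆ Ioo a 1 := Ioo_subset_Ioo_right hb.le
    have := (contDiffOn_succ_iff_deriv_of_isOpen (𝕜 := ℝ) (n := 0)
      (f := fun s => s / c s) (isOpen_Ioo (a := a) (b := b))).2
      ⟨fun r hr => (hρ r (hs1 hr)).differentiableAt.differentiableWithinAt, by simp, by
        rw [contDiffOn_zero]
        refine ContinuousOn.congr (f := fun s => (c s - s * c' s) / c s ^ 2) ?_
          fun r hr => (hρ r (hs1 hr)).deriv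
        refine ContinuousOn.mono (s := Icc a 1) ?_ (hs1.trans Ioo_subset_Icc_self)
        exact (hcc.sub (continuousOn_id.mul hcc')).div (hcc.pow 2)
          fun s hs => (pow_pos (hcpos s hs) 2).ne'⟩
    simpa using this
  have hsq : ∀ r ∈ Ioo a b, ∀ s ∈ Icc r 1,
      (√(1 - (r * c s / (s * c r)) ^ 2))⁻¹ = (s / c s) / √(p s - p r) := by
    intro r hr s hs
    have hr' : r ∈ Icc a 1 := ⟨hr.1.le, (hr.2.trans hb).le⟩
    have hs' : s ∈ Icc a 1 := ⟨hr.1.le.trans hs.1, hs.2⟩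
    have h1 := hcpos r hr'
    have h2 := hcpos s hs'
    have h3 := hspos s hs'
    have e : 1 - (r * c s / (s * c r)) ^ 2 = (p s - p r) / (s / c s) ^ 2 := by
      simp only [p]
      field_simp
    have h4 : 0 < s / c s := by positivity
    rw [e, Real.sqrt_div' _ (by positivity), Real.sqrt_sq h4.le, inv_div]
  constructor
  · refine (hρC.mul hα).congr fun r hr => ?_
    have hr1 : r ≤ 1 := (hr.2.trans hb).le
    simp only [alphaFun]
    rw [← intervalIntegral.integral_const_mul]
    refine intervalIntegral.integral_congr fun s hs => ?_
    rw [uIcc_of_le hr1] at hs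
    have hr' : r ∈ Icc a 1 := ⟨hr.1.le, hr1⟩
    have hs' : s ∈ Icc a 1 := ⟨hr.1.le.trans hs.1, hs.2⟩
    have h1 := (hcpos r hr').ne'
    have h2 := (hcpos s hs').ne'
    have h3 := (hspos s hs').ne'
    simp only [hsq r hr s hs, div_eq_mul_inv _ (√(p s - p r))]
    field_simp
  · refine hL.congr fun r hr => ?_
    have hr1 : r ≤ 1 := (hr.2.trans hb).le
    simp only [Lfun]
    refine intervalIntegral.integral_congr fun s hs => ?_
    rw [uIcc_of_le hr1] at hs
    have hs' : s ∈ Icc a 1 := ⟨hr.1.le.trans hs.1, hs.2⟩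
    have h2 := (hcpos s hs').ne'
    simp only [hsq r hr s hs, div_eq_mul_inv _ (√(p s - p r))]
    field_simp

theorem stmt0 (R : ℝ) (hR0 : 0 ≤ R) (hR1 : R < 1) (c : ℝ → ℝ)
    (hpos : ∀ r ∈ Set.Icc R 1, 0 < c r)
    (hC11 : IsC11On c R) (hHerg : HerglotzCond c R) :
    ContDiffOn ℝ 1 (alphaFun c) (Set.Ioo R 1) ∧ ContDiffOn ℝ 1 (Lfun c) (Set.Ioo R 1) := by
  have key : ∀ r ∈ Ioo R 1, ContDiffAt ℝ 1 (alphaFun c) r ∧ ContDiffAt ℝ 1 (Lfun c) r := by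
    intro r hr
    obtain ⟨h1, h2⟩ := hr
    have := local_main R hR0 c hpos hC11 hHerg ((R + r) / 2) ((r + 1) / 2) (by linarith)
      (by linarith) (by linarith)
    have hn : Ioo ((R + r) / 2) ((r + 1) / 2) ∈ 𝓝 r := Ioo_mem_nhds (by linarith) (by linarith)
    exact ⟨this.1.contDiffAt hn, this.2.contDiffAt hn⟩
  exact ⟨fun r hr => (key r hr).1.contDiffWithinAt, fun r hr => (key r hr).2.contDiffWithinAt⟩
end

section
/- Let 0 ≤ R < 1 and let c : [R,1] → (0,∞) be C^{1,1}, satisfy the Herglotz condition, and satisfy the countable conjugacy condition. Then the set C = {r ∈ (R,1) : α'(r) = 0} is countable and relatively closed in (R,1), and the set P = {r ∈ (R,1) : α(r) ∈ π·ℚ} is countable and dense in (R,1). -/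
open MeasureTheory Set Filter Topology

lemma aux_transl_cont (g k : ℝ → ℝ) (M : ℝ) (hg : Measurable g) (hM : ∀ x, |g x| ≤ M)
    (hk : Integrable k) : Continuous (fun y => ∫ z, g (y + z) * k z) := by
  have hM0 : 0 ≤ M := (abs_nonneg _).trans (hM 0)
  have hint : ∀ (k : ℝ → ℝ), Integrable k → ∀ y, Integrable (fun z => g (y + z) * k z) := by
    intro k hk y
    exact hk.bdd_mul (c := M) (hg.comp (measurable_const_add y)).aestronglyMeasurable
      (Eventually.of_forall fun z => hM _)
  apply continuous_of_uniform_approx_of_continuous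
  intro u hu
  obtain ⟨ε, hε, hεu⟩ := Metric.mem_uniformity_dist.1 hu
  obtain ⟨k', hk's, hk'd, hk'c, hk'i⟩ :=
    hk.exists_hasCompactSupport_integral_sub_le (ε := ε / (2 * (M + 1))) (by positivity)
  refine ⟨fun y => ∫ z, g (y + z) * k' z, ?_, ?_⟩
  · have h1 : Continuous (convolution g (fun z => k' (-z)) (ContinuousLinearMap.mul ℝ ℝ) volume) := by
      apply HasCompactSupport.continuous_convolution_right
      · exact hk's.comp_homeomorph (Homeomorph.neg ℝ)
      · have hb : LocallyIntegrable (fun _ : ℝ => M) volume := locallyIntegrable_const M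
        refine hb.mono hg.aestronglyMeasurable (Eventually.of_forall fun z => ?_)
        simpa [abs_of_nonneg hM0] using hM z
      · exact hk'c.comp continuous_neg
    convert h1 using 2 with y
    simp only [convolution, ContinuousLinearMap.mul_apply']
    rw [← integral_add_left_eq_self (μ := volume) (fun t => g t * k' (-(y - t))) y]
    congr 1
    ext z
    congr 2
    ring
  · intro y
    apply hεu
    rw [Real.dist_eq, ← integral_sub (hint k hk y) (hint k' hk'i y)]
    have h2 : ‖∫ z, (g (y + z) * k z - g (y + z) * k' z)‖ ≤ ∫ z, M * ‖k z - k' z‖ := by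
      apply norm_integral_le_of_norm_le
      · exact ((hk.sub hk'i).norm).const_mul M
      · refine Eventually.of_forall fun z => ?_
        rw [← mul_sub, norm_mul]
        exact mul_le_mul_of_nonneg_right (hM _) (norm_nonneg _)
    rw [Real.norm_eq_abs, integral_const_mul] at h2
    calc _ ≤ _ := h2
      _ ≤ M * (ε / (2 * (M + 1))) := by gcongr
      _ < ε := by
        rw [mul_div_assoc', div_lt_iff₀ (by positivity)]
        nlinarith

lemma aux_conv_contDiff (f k : ℝ → ℝ) (K : NNReal) (M : ℝ) (hf : LipschitzWith K f)
    (hM : ∀ x, |f x| ≤ M) (hk : Integrable k) :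
    ContDiff ℝ 1 (fun y => ∫ z, f (y + z) * k z) := by
  have key : ∀ y, HasDerivAt (fun y => ∫ z, f (y + z) * k z) (∫ z, deriv f (y + z) * k z) y := by
    intro y
    refine (hasDerivAt_integral_of_dominated_loc_of_lip (bound := fun z => K * ‖k z‖)
      (F := fun y z => f (y + z) * k z) (F' := fun z => deriv f (y + z) * k z)
      (s := univ) (x₀ := y) univ_mem ?_ ?_ ?_ ?_ ?_ ?_).2
    · refine Eventually.of_forall fun x => ?_
      exact ((hf.continuous.comp (continuous_const.add continuous_id)).aestronglyMeasurable).mul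
        hk.aestronglyMeasurable
    · exact hk.bdd_mul (c := M)
        (hf.continuous.comp (continuous_const.add continuous_id)).aestronglyMeasurable
        (Eventually.of_forall fun z => hM _)
    · exact ((measurable_deriv f).comp (measurable_const_add y)).aestronglyMeasurable.mul
        hk.aestronglyMeasurable
    · refine Eventually.of_forall fun z => ?_
      apply LipschitzOnWith.of_dist_le_mul
      intro a _ b _
      have h := hf.dist_le_mul (a + z) (b + z)
      rw [Real.dist_eq, Real.dist_eq] at *
      have hb : |(K : ℝ) * ‖k z‖| = K * |k z| := by
        rw [abs_of_nonneg (by positivity), Real.norm_eq_abs]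
      rw [← sub_mul, abs_mul, Real.coe_nnabs, hb]
      rw [add_sub_add_right_eq_sub] at h
      nlinarith [abs_nonneg (k z)]
    · exact hk.norm.const_mul _
    · have h1 : ∀ᵐ x : ℝ, DifferentiableAt ℝ f x := hf.ae_differentiableAt
      have h2 := (measurePreserving_add_left (volume : Measure ℝ) y).quasiMeasurePreserving.ae h1
      filter_upwards [h2] with z hz
      exact (hz.hasDerivAt.comp_add_const y z).mul_const (k z)
  rw [contDiff_one_iff_deriv]
  refine ⟨fun y => (key y).differentiableAt, ?_⟩
  have : deriv (fun y => ∫ z, f (y + z) * k z) = fun y => ∫ z, deriv f (y + z) * k z :=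
    funext fun y => (key y).deriv
  rw [this]
  exact aux_transl_cont _ k K (measurable_deriv f) (fun x => norm_deriv_le_of_lipschitz hf) hk

noncomputable def auxKer (z : ℝ) : ℝ := Real.exp (-z) * (Real.sqrt (1 - Real.exp (-z) ^ 2))⁻¹

lemma auxKer_meas : Measurable auxKer := by
  unfold auxKer; fun_prop

lemma auxKer_pos_arg {z : ℝ} (hz : 0 < z) : 0 < 1 - Real.exp (-z) ^ 2 := by
  have h1 : Real.exp (-z) < 1 := by simpa using hz
  nlinarith [Real.exp_pos (-z)]

lemma auxKer_contAt {z : ℝ} (hz : 0 < z) : ContinuousAt auxKer z := by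
  unfold auxKer
  have := (Real.sqrt_pos.2 (auxKer_pos_arg hz)).ne'
  fun_prop (disch := assumption)

lemma auxKer_nonneg (z : ℝ) : 0 ≤ auxKer z := by
  unfold auxKer; positivity

lemma auxKer_le {z : ℝ} (hz : 0 < z) : auxKer z ≤ z ^ (-(1/2) : ℝ) := by
  have hp := Real.sqrt_pos.2 (auxKer_pos_arg hz)
  have h0 : Real.exp (-z) * Real.sqrt z ≤ Real.sqrt (1 - Real.exp (-z) ^ 2) := by
    apply Real.le_sqrt_of_sq_le
    rw [mul_pow, Real.sq_sqrt hz.le]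
    have h3 : Real.exp (-z) * Real.exp z = 1 := by rw [← Real.exp_add]; simp
    have h4 := Real.add_one_le_exp z
    have h5 := Real.exp_pos (-z)
    have h6 : Real.exp (-z) * (z + 1) ≤ 1 := by nlinarith
    have h7 : Real.exp (-z) ≤ 1 := by nlinarith
    nlinarith [mul_pos h5 h5]
  have hs := Real.sqrt_pos.2 hz
  rw [Real.rpow_neg hz.le, ← Real.sqrt_eq_rpow]
  unfold auxKer
  rw [← div_eq_mul_inv, div_le_iff₀ hp, ← div_eq_inv_mul, le_div_iff₀ hs]
  exact h0

lemma auxKer_intOn (Z : ℝ) : IntegrableOn auxKer (Ioc 0 Z) := by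
  rcases le_or_gt Z 0 with h | h
  · rw [Ioc_eq_empty (by linarith)]; exact integrableOn_empty
  have h1 : IntervalIntegrable (fun x : ℝ => x ^ (-(1/2) : ℝ)) volume 0 Z :=
    intervalIntegral.intervalIntegrable_rpow' (by norm_num)
  rw [intervalIntegrable_iff_integrableOn_Ioc_of_le h.le] at h1
  refine Integrable.mono' h1 auxKer_meas.aestronglyMeasurable ?_
  filter_upwards [ae_restrict_mem measurableSet_Ioc] with z hz
  rw [Real.norm_eq_abs, abs_of_nonneg (auxKer_nonneg z)]
  exact auxKer_le hz.1

/-- the truncated convolution is `C^1` -/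
lemma aux_A_contDiff (f : ℝ → ℝ) (K : NNReal) (M x0 x1 : ℝ) (hf : LipschitzWith K f)
    (hM : ∀ x, |f x| ≤ M) (hconst : ∀ x, x1 ≤ x → f x = f x1) (y : ℝ) (hy0 : x0 < y) (hy1 : y < x1) :
    ContDiffAt ℝ 1 (fun y => ∫ z in Ioc 0 (x1 - y), f (y + z) * auxKer z) y := by
  set Z := x1 - x0 with hZ
  have h1 : ContDiff ℝ 1 (fun y => ∫ z, f (y + z) * (Ioc 0 Z).indicator auxKer z) :=
    aux_conv_contDiff f _ K M hf hM
      ((integrable_indicator_iff measurableSet_Ioc).2 (auxKer_intOn Z))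
  have hint : ∀ a b, 0 ≤ a → IntegrableOn auxKer (Ioc a b) := fun a b ha =>
    (auxKer_intOn b).mono_set (Ioc_subset_Ioc_left ha)
  have h2 : ContDiffAt ℝ 1 (fun u => ∫ z in u..Z, auxKer z) (x1 - y) := by
    have hO : ContDiffOn ℝ 1 (fun u => ∫ z in u..Z, auxKer z) (Ioo 0 Z) := by
      have hd : ∀ u ∈ Ioo 0 Z, HasDerivAt (fun u => ∫ z in u..Z, auxKer z) (- auxKer u) u := by
        intro u hu
        apply intervalIntegral.integral_hasDerivAt_left
        · rw [intervalIntegrable_iff_integrableOn_Ioc_of_le hu.2.le]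
          exact hint _ _ hu.1.le
        · exact auxKer_meas.stronglyMeasurable.stronglyMeasurableAtFilter
        · exact auxKer_contAt hu.1
      rw [show (1 : WithTop ℕ∞) = 0 + 1 by simp, contDiffOn_succ_iff_deriv_of_isOpen isOpen_Ioo]
      refine ⟨fun u hu => (hd u hu).differentiableAt.differentiableWithinAt, by simp, ?_⟩
      rw [contDiffOn_zero]
      refine ContinuousOn.congr (f := fun u => - auxKer u) ?_ fun u hu => (hd u hu).deriv
      exact fun u hu => (auxKer_contAt hu.1).neg.continuousWithinAt
    exact hO.contDiffAt (Ioo_mem_nhds (by linarith) (by linarith))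
  have h3 : ContDiffAt ℝ 1 (fun y => (∫ z, f (y + z) * (Ioc 0 Z).indicator auxKer z) -
      f x1 * ∫ z in (x1 - y)..Z, auxKer z) y := by
    refine h1.contDiffAt.sub (contDiffAt_const.mul ?_)
    exact ContDiffAt.comp y (g := fun u => ∫ z in u..Z, auxKer z) (f := fun y => x1 - y) h2
      (contDiffAt_const.sub contDiffAt_id)
  refine h3.congr_of_eventuallyEq ?_
  filter_upwards [Ioo_mem_nhds hy0 hy1] with w hw
  have e1 : (fun z => f (w + z) * (Ioc 0 Z).indicator auxKer z) =
      (Ioc 0 Z).indicator (fun z => f (w + z) * auxKer z) := by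
    ext z; by_cases hz : z ∈ Ioc 0 Z <;> simp [hz]
  have hI : IntegrableOn (fun z => f (w + z) * auxKer z) (Ioc 0 Z) :=
    (auxKer_intOn Z).bdd_mul (c := M)
        (hf.continuous.comp (continuous_const.add continuous_id)).aestronglyMeasurable
        (Eventually.of_forall fun z => hM _)
  have e2 : Ioc 0 Z = Ioc 0 (x1 - w) ∪ Ioc (x1 - w) Z :=
    (Ioc_union_Ioc_eq_Ioc (by linarith [hw.2]) (by linarith [hw.1])).symm
  rw [e1, integral_indicator measurableSet_Ioc, e2, setIntegral_union
    (Ioc_disjoint_Ioc_of_le le_rfl) measurableSet_Ioc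
    (hI.mono_set (by rw [e2]; exact subset_union_left))
    (hI.mono_set (by rw [e2]; exact subset_union_right)),
    intervalIntegral.integral_of_le (by linarith [hw.1]), ← integral_const_mul]
  have e3 : ∫ z in Ioc (x1 - w) Z, f (w + z) * auxKer z = ∫ z in Ioc (x1 - w) Z, f x1 * auxKer z := by
    apply setIntegral_congr_fun measurableSet_Ioc
    intro z hz
    simp only
    rw [hconst _ (by linarith [hz.1])]
  rw [e3]; ring

lemma aux_level_countable (a : ℝ → ℝ) (v : ℝ) : {r | deriv a r ≠ 0 ∧ a r = v}.Countable := by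
  have h : ∀ x ∈ {r | deriv a r ≠ 0 ∧ a r = v}, ({x} : Set ℝ) ∈ 𝓝[{r | deriv a r ≠ 0 ∧ a r = v}] x := by
    intro x hx
    have hd : DifferentiableAt ℝ a x := by
      by_contra h; exact hx.1 (deriv_zero_of_not_differentiableAt h)
    have := hd.hasDerivAt.eventually_ne (c := v) hx.1
    rw [eventually_nhdsWithin_iff] at this
    rw [mem_nhdsWithin_iff_eventually]
    filter_upwards [this] with y hy hy2
    by_contra hne
    exact hy hne hy2.2
  obtain ⟨t, -, htc, ht⟩ := TopologicalSpace.countable_cover_nhdsWithin h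
  exact htc.mono (by simpa using ht)

lemma aux_final (R : ℝ) (hR1 : R < 1) (a : ℝ → ℝ) (hC : ∀ r ∈ Ioo R 1, ContDiffAt ℝ 1 a r)
    (hccc : {r | r ∈ Set.Ioo R 1 ∧ deriv a r = 0}.Countable) :
    {r | r ∈ Set.Ioo R 1 ∧ deriv a r = 0}.Countable ∧
    closure {r | r ∈ Set.Ioo R 1 ∧ deriv a r = 0} ∩ Set.Ioo R 1 ⊆
      {r | r ∈ Set.Ioo R 1 ∧ deriv a r = 0} ∧
    {r | r ∈ Set.Ioo R 1 ∧ ∃ q : ℚ, a r = (q : ℝ) * Real.pi}.Countable ∧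
    Set.Ioo R 1 ⊆
      closure {r | r ∈ Set.Ioo R 1 ∧ ∃ q : ℚ, a r = (q : ℝ) * Real.pi} := by
  refine ⟨hccc, ?_, ?_, ?_⟩
  · rintro r ⟨hrc, hr⟩
    refine ⟨hr, ?_⟩
    have hcont : ContinuousAt (deriv a) r :=
      ((hC r hr).derivWithin (m := 0) (by simp)).continuousAt
    by_contra hne
    have h1 := hcont.eventually_ne hne
    obtain ⟨x, hx1, hx2⟩ := mem_closure_iff_nhds.1 hrc _ h1
    exact hx1 hx2.2
  · refine (hccc.union (countable_iUnion fun q : ℚ =>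
      aux_level_countable a ((q : ℝ) * Real.pi))).mono ?_
    rintro r ⟨hr, q, hq⟩
    by_cases h : deriv a r = 0
    · exact Or.inl ⟨hr, h⟩
    · exact Or.inr (mem_iUnion.2 ⟨q, h, hq⟩)
  · intro r hr
    rw [mem_closure_iff_nhds]
    intro t ht
    obtain ⟨l, u, ⟨hl, hu⟩, hlu⟩ := mem_nhds_iff_exists_Ioo_subset.1
      (inter_mem ht (Ioo_mem_nhds hr.1 hr.2))
    have hcont : ContinuousOn a (Ioo l u) := fun x hx =>
      (hC x (hlu hx).2).continuousAt.continuousWithinAt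
    -- not constant
    obtain ⟨x, hx, hxr⟩ : ∃ x ∈ Ioo l u, a x ≠ a r := by
      by_contra! hcon
      have hsub : Ioo l u ⊆ {r | r ∈ Set.Ioo R 1 ∧ deriv a r = 0} := by
        intro x hx
        refine ⟨(hlu hx).2, ?_⟩
        have : a =ᶠ[𝓝 x] fun _ => a r := by
          filter_upwards [Ioo_mem_nhds hx.1 hx.2] with w hw using hcon w hw
        rw [this.deriv_eq]; simp
      have := hccc.mono hsub
      have hc : ¬ (Ioo l u).Countable := by
        intro h
        have := (Cardinal.mk_Ioo_real (hl.trans hu))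
        have h2 := Cardinal.le_aleph0_iff_set_countable.2 h
        rw [this] at h2
        exact absurd h2 (not_le.2 Cardinal.aleph0_lt_continuum)
      exact hc this
    have hcv : OrdConnected (a '' Ioo l u) :=
      ((isPreconnected_Ioo).image a hcont).ordConnected
    have hmin : min (a x) (a r) < max (a x) (a r) := min_lt_max.2 hxr
    obtain ⟨q, hq1, hq2⟩ := exists_rat_btwn (div_lt_div_of_pos_right hmin Real.pi_pos)
    rw [div_lt_iff₀ Real.pi_pos] at hq1
    rw [lt_div_iff₀ Real.pi_pos] at hq2
    have hmem : (q : ℝ) * Real.pi ∈ a '' Ioo l u :=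
      hcv.uIcc_subset (mem_image_of_mem a hx) (mem_image_of_mem a ⟨hl, hu⟩) ⟨hq1.le, hq2.le⟩
    obtain ⟨w, hw, hwq⟩ := hmem
    exact ⟨w, (hlu hw).1, (hlu hw).2, q, hwq⟩

lemma aux_quot_lip (c c' D : ℝ → ℝ) (r0 : ℝ) (K : NNReal) (hr0 : 0 < r0) 
    (hc : ∀ r ∈ Icc r0 1, HasDerivWithinAt c (c' r) (Icc r0 1) r)
    (hK : LipschitzOnWith K c' (Icc r0 1)) 
    (hDdef : ∀ s, D s = c s - s * c' s) (hD : ∀ s ∈ Icc r0 1, 0 < D s) :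
    ∃ C : ℝ, 0 ≤ C ∧ ∀ s ∈ Icc r0 1, ∀ t ∈ Icc r0 1, |c s / D s - c t / D t| ≤ C * |s - t| := by
  rcases (Icc r0 1).eq_empty_or_nonempty with he | hne
  · exact ⟨0, le_rfl, by simp [he]⟩
  have hcc : ContinuousOn c (Icc r0 1) := fun s hs => (hc s hs).continuousWithinAt
  have hc'c : ContinuousOn c' (Icc r0 1) := hK.continuousOn
  have hDc : ContinuousOn D (Icc r0 1) := by
    rw [show D = fun s => c s - s * c' s from funext hDdef]
    exact hcc.sub (continuousOn_id.mul hc'c)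
  obtain ⟨Mc, hMc⟩ := isCompact_Icc.exists_bound_of_continuousOn hcc
  obtain ⟨M', hM'⟩ := isCompact_Icc.exists_bound_of_continuousOn hc'c
  obtain ⟨Md, hMd⟩ := isCompact_Icc.exists_bound_of_continuousOn hDc
  obtain ⟨x, hx, hxm⟩ := isCompact_Icc.exists_isMinOn hne hDc
  have hd := hD x hx
  set d := D x
  have hdm : ∀ s ∈ Icc r0 1, d ≤ D s := fun s hs => hxm hs
  simp only [Real.norm_eq_abs] at hMc hM' hMd
  have hMc0 := (abs_nonneg _).trans (hMc x hx)
  have hM'0 := (abs_nonneg _).trans (hM' x hx)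
  have hMd0 := (abs_nonneg _).trans (hMd x hx)
  have hcl : ∀ s ∈ Icc r0 1, ∀ t ∈ Icc r0 1, |c s - c t| ≤ M' * |s - t| := by
    intro s hs t ht
    have := (convex_Icc r0 1).norm_image_sub_le_of_norm_hasDerivWithin_le hc hM' ht hs
    simpa using this
  have hDl : ∀ s ∈ Icc r0 1, ∀ t ∈ Icc r0 1, |D s - D t| ≤ (M' + K + M') * |s - t| := by
    intro s hs t ht
    have h1 := hcl s hs t ht
    have h2 : |c' s - c' t| ≤ K * |s - t| := hK.dist_le_mul s hs t ht
    have h3 : |s * (c' s - c' t)| ≤ K * |s - t| := by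
      rw [abs_mul, abs_of_pos (hr0.trans_le hs.1)]
      exact (mul_le_of_le_one_left (abs_nonneg _) hs.2).trans h2
    have h4 : |(s - t) * c' t| ≤ M' * |s - t| := by
      rw [abs_mul, mul_comm]
      exact mul_le_mul_of_nonneg_right (hM' t ht) (abs_nonneg _)
    have : D s - D t = (c s - c t) - s * (c' s - c' t) - (s - t) * c' t := by
      rw [hDdef, hDdef]; ring
    rw [this]
    calc _ ≤ |c s - c t| + |s * (c' s - c' t)| + |(s - t) * c' t| :=
          (abs_sub _ _).trans (add_le_add_left (abs_sub _ _) _)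
      _ ≤ _ := by linarith
  refine ⟨(M' * Md + Mc * (M' + K + M')) / (d * d), by positivity, ?_⟩
  intro s hs t ht
  have hDs := hD s hs
  have hDt := hD t ht
  have e : c s / D s - c t / D t = ((c s - c t) * D t - c t * (D s - D t)) / (D s * D t) := by
    field_simp; ring
  rw [e, abs_div, abs_of_pos (mul_pos hDs hDt), div_mul_eq_mul_div]
  apply div_le_div₀ (by positivity) _ (by positivity)
    (mul_le_mul (hdm s hs) (hdm t ht) hd.le hDs.le)
  calc _ ≤ |c s - c t| * |D t| + |c t| * |D s - D t| := by
        rw [← abs_mul, ← abs_mul]; exact abs_sub _ _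
    _ ≤ (M' * |s - t|) * Md + Mc * ((M' + K + M') * |s - t|) := by
        gcongr
        · exact hcl s hs t ht
        · exact hMd t ht
        · exact hMc t ht
        · exact hDl s hs t ht
    _ = _ := by ring

lemma aux_alpha_contDiffAt (c c' : ℝ → ℝ) (r0 : ℝ) (K : NNReal) (hr0 : 0 < r0)
    (hpos : ∀ r ∈ Icc r0 1, 0 < c r)
    (hc : ∀ r ∈ Icc r0 1, HasDerivWithinAt c (c' r) (Icc r0 1) r)
    (hK : LipschitzOnWith K c' (Icc r0 1))
    (hD : ∀ s ∈ Icc r0 1, 0 < c s - s * c' s) (r : ℝ) (hr : r ∈ Ioo r0 1) :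
    ContDiffAt ℝ 1 (alphaFun c) r := by
  have hr01 : r0 < 1 := hr.1.trans hr.2
  have hcc : ContinuousOn c (Icc r0 1) := fun s hs => (hc s hs).continuousWithinAt
  have hc'c : ContinuousOn c' (Icc r0 1) := hK.continuousOn
  set D : ℝ → ℝ := fun s => c s - s * c' s with hDdef
  set F : ℝ → ℝ := fun s => c s / D s with hF
  obtain ⟨C, hC0, hC⟩ := aux_quot_lip c c' D r0 K hr0 hc hK (fun _ => rfl) hD
  have hDc : ContinuousOn D (Icc r0 1) := hcc.sub (continuousOn_id.mul hc'c)
  have hFc : ContinuousOn F (Icc r0 1) := hcc.div hDc fun s hs => (hD s hs).ne'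
  obtain ⟨M, hM⟩ := isCompact_Icc.exists_bound_of_continuousOn hFc
  set lam : ℝ → ℝ := fun s => Real.log s - Real.log (c s) with hlam
  set lam' : ℝ → ℝ := fun s => s⁻¹ - c' s / c s with hlam'
  have hsp : ∀ s ∈ Icc r0 1, 0 < s := fun s hs => hr0.trans_le hs.1
  have hlF : ∀ s ∈ Icc r0 1, lam' s * F s = s⁻¹ := by
    intro s hs
    have h1 := (hpos s hs).ne'
    have h2 := (hsp s hs).ne'
    have h3 : c s - s * c' s ≠ 0 := (hD s hs).ne'
    simp only [hlam', hF, hDdef]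
    field_simp
  have hFp : ∀ s ∈ Icc r0 1, 0 < F s := fun s hs => div_pos (hpos s hs) (hD s hs)
  have hlp : ∀ s ∈ Icc r0 1, 0 < lam' s := by
    intro s hs
    have h := hlF s hs
    have h2 := inv_pos.2 (hsp s hs)
    rw [← h] at h2
    exact pos_of_mul_pos_left h2 (hFp s hs).le
  have hld : ∀ s ∈ Icc r0 1, HasDerivWithinAt lam (lam' s) (Icc r0 1) s := by
    intro s hs
    exact (Real.hasDerivAt_log (hsp s hs).ne').hasDerivWithinAt.sub
      ((hc s hs).log (hpos s hs).ne')
  have hlc : ContinuousOn lam (Icc r0 1) := fun s hs => (hld s hs).continuousWithinAt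
  have hl'c : ContinuousOn lam' (Icc r0 1) :=
    (continuousOn_id.inv₀ fun s hs => (hsp s hs).ne').sub
      (hc'c.div hcc fun s hs => (hpos s hs).ne')
  obtain ⟨xm, hxm, hmin⟩ := isCompact_Icc.exists_isMinOn (nonempty_Icc.2 hr01.le) hl'c
  have hm := hlp xm hxm
  set m := lam' xm
  have hldAt : ∀ s ∈ Ioo r0 1, HasDerivAt lam (lam' s) s := fun s hs =>
    (hld s (Ioo_subset_Icc_self hs)).hasDerivAt (Icc_mem_nhds hs.1 hs.2)
  have hexp : ∀ s ∈ Icc r0 1, ∀ t ∈ Icc r0 1, s ≤ t → m * (t - s) ≤ lam t - lam s := by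
    apply (convex_Icc r0 1).mul_sub_le_image_sub_of_le_deriv hlc
    · rw [interior_Icc]
      exact fun s hs => (hldAt s hs).differentiableAt.differentiableWithinAt
    · rw [interior_Icc]
      intro s hs
      rw [(hldAt s hs).deriv]
      exact hmin (Ioo_subset_Icc_self hs)
  have hmono : StrictMonoOn lam (Icc r0 1) := by
    intro s hs t ht hst
    have := hexp s hs t ht hst.le
    nlinarith
  have habs : ∀ s ∈ Icc r0 1, ∀ t ∈ Icc r0 1, m * |s - t| ≤ |lam s - lam t| := by
    intro s hs t ht
    rcases le_total s t with h | h
    · rw [abs_sub_comm s, abs_sub_comm (lam s), abs_of_nonneg (sub_nonneg.2 h)]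
      exact (hexp s hs t ht h).trans (le_abs_self _)
    · rw [abs_of_nonneg (sub_nonneg.2 h)]
      exact (hexp t ht s hs h).trans (le_abs_self _)
  have h0mem : r0 ∈ Icc r0 1 := left_mem_Icc.2 hr01.le
  have h1mem : (1 : ℝ) ∈ Icc r0 1 := right_mem_Icc.2 hr01.le
  set x0 := lam r0 with hx0
  set x1 := lam 1 with hx1
  have hx01 : x0 < x1 := hmono h0mem h1mem hr01
  have hsurj : ∀ x ∈ Icc x0 x1, ∃ s ∈ Icc r0 1, lam s = x := fun x hx =>
    intermediate_value_Icc hr01.le hlc hx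
  choose! sig hsig1 hsig2 using hsurj
  set f : ℝ → ℝ := fun x => F (sig (projIcc x0 x1 hx01.le x)) with hf
  have hflam : ∀ s ∈ Icc r0 1, f (lam s) = F s := by
    intro s hs
    have hmem : lam s ∈ Icc x0 x1 :=
      ⟨hmono.monotoneOn h0mem hs hs.1, hmono.monotoneOn hs h1mem hs.2⟩
    simp only [hf]
    rw [projIcc_of_mem _ hmem]
    congr 1
    exact hmono.injOn (hsig1 _ hmem) hs (hsig2 _ hmem)
  have hfL : LipschitzWith (Real.toNNReal (C / m)) f := by
    apply LipschitzWith.of_dist_le_mul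
    intro x y
    rw [Real.coe_toNNReal _ (by positivity)]
    have hp := (LipschitzWith.projIcc hx01.le).dist_le_mul x y
    rw [Subtype.dist_eq] at hp
    simp only [hf]
    generalize hX : projIcc x0 x1 hx01.le x = X at *
    generalize hY : projIcc x0 x1 hx01.le y = Y at *
    have h1 := hC _ (hsig1 _ X.2) _ (hsig1 _ Y.2)
    have h2 := habs _ (hsig1 _ X.2) _ (hsig1 _ Y.2)
    rw [hsig2 _ X.2, hsig2 _ Y.2] at h2
    simp only [Real.dist_eq, NNReal.coe_one, one_mul] at *
    calc _ ≤ _ := h1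
      _ = C / m * (m * |sig X - sig Y|) := by field_simp
      _ ≤ C / m * |x - y| := by gcongr; exact h2.trans hp
  have hfM : ∀ x, |f x| ≤ M := fun x => hM _ (hsig1 _ (projIcc x0 x1 hx01.le x).2)
  have hfconst : ∀ x, x1 ≤ x → f x = f x1 := by
    intro x hx
    simp only [hf]
    rw [projIcc_of_right_le _ hx, projIcc_right]
  -- the change of variables
  have hα : ∀ w ∈ Ioo r0 1, alphaFun c w =
      ∫ z in Ioc 0 (x1 - lam w), f (lam w + z) * auxKer z := by
    intro w hw
    have hwI : w ∈ Icc r0 1 := Ioo_subset_Icc_self hw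
    have hsub : Ioc w 1 ⊆ Icc r0 1 := fun s hs => ⟨hw.1.le.trans hs.1.le, hs.2⟩
    have himg : lam '' Ioc w 1 = Ioc (lam w) x1 := by
      apply Subset.antisymm
      · rintro _ ⟨s, hs, rfl⟩
        exact ⟨hmono hwI (hsub hs) hs.1, hmono.monotoneOn (hsub hs) h1mem hs.2⟩
      · intro x hx
        have hxI : x ∈ Icc x0 x1 :=
          ⟨(hmono.monotoneOn h0mem hwI hwI.1).trans hx.1.le, hx.2⟩
        refine ⟨sig x, ⟨?_, (hsig1 x hxI).2⟩, hsig2 x hxI⟩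
        rw [← hmono.lt_iff_lt hwI (hsig1 x hxI), hsig2 x hxI]
        exact hx.1
    have hcv := integral_image_eq_integral_abs_deriv_smul (s := Ioc w 1) measurableSet_Ioc
      (fun s hs => (hld s (hsub hs)).mono hsub) (hmono.injOn.mono hsub)
      (fun x => f x * auxKer (x - lam w))
    have hlw : lam w < x1 := hmono hwI h1mem hw.2
    have htr := intervalIntegral.integral_comp_add_left (a := 0) (b := x1 - lam w)
      (fun x => f x * auxKer (x - lam w)) (lam w)
    rw [add_zero, add_sub_cancel, intervalIntegral.integral_of_le (by linarith),
      intervalIntegral.integral_of_le hlw.le, ← himg, hcv] at htr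
    simp only [add_sub_cancel_left] at htr
    rw [htr, alphaFun, intervalIntegral.integral_of_le hw.2.le]
    apply setIntegral_congr_fun measurableSet_Ioc
    intro s hs
    have hsI := hsub hs
    have h1 := hpos s hsI
    have h2 := hsp s hsI
    have h3 := hpos w hwI
    have h4 := hsp w hwI
    have hE : Real.exp (-(lam s - lam w)) = w * c s / (s * c w) := by
      have : -(lam s - lam w) = Real.log w + Real.log (c s) - (Real.log s + Real.log (c w)) := by
        simp only [hlam]; ring
      rw [this, Real.exp_sub, Real.exp_add, Real.exp_add, Real.exp_log h1, Real.exp_log h2,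
        Real.exp_log h3, Real.exp_log h4]
    simp only [smul_eq_mul]
    rw [abs_of_pos (hlp s hsI), hflam s hsI, ← mul_assoc, hlF s hsI, auxKer, hE, ← mul_assoc]
    congr 1
    field_simp
  have hrI := Ioo_subset_Icc_self hr
  have hA := aux_A_contDiff f _ M x0 x1 hfL hfM hfconst (lam r) (hmono h0mem hrI hr.1)
    (hmono hrI h1mem hr.2)
  have hlC : ContDiffAt ℝ 1 lam r := by
    have hO : ContDiffOn ℝ 1 lam (Ioo r0 1) := by
      rw [show (1 : WithTop ℕ∞) = 0 + 1 by simp, contDiffOn_succ_iff_deriv_of_isOpen isOpen_Ioo]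
      refine ⟨fun u hu => (hldAt u hu).differentiableAt.differentiableWithinAt, by simp, ?_⟩
      rw [contDiffOn_zero]
      exact (hl'c.mono Ioo_subset_Icc_self).congr fun u hu => (hldAt u hu).deriv
    exact hO.contDiffAt (Ioo_mem_nhds hr.1 hr.2)
  refine (ContDiffAt.comp r (f := lam) hA hlC).congr_of_eventuallyEq ?_
  filter_upwards [Ioo_mem_nhds hr.1 hr.2] with w hw using hα w hw

theorem stmt2 (R : ℝ) (hR0 : 0 ≤ R) (hR1 : R < 1) (c : ℝ → ℝ)
    (hpos : ∀ r ∈ Set.Icc R 1, 0 < c r)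
    (hC11 : IsC11On c R) (hHerg : HerglotzCond c R)
    (hccc : {r | r ∈ Set.Ioo R 1 ∧ deriv (alphaFun c) r = 0}.Countable) :
    {r | r ∈ Set.Ioo R 1 ∧ deriv (alphaFun c) r = 0}.Countable ∧
    closure {r | r ∈ Set.Ioo R 1 ∧ deriv (alphaFun c) r = 0} ∩ Set.Ioo R 1 ⊆
      {r | r ∈ Set.Ioo R 1 ∧ deriv (alphaFun c) r = 0} ∧
    {r | r ∈ Set.Ioo R 1 ∧ ∃ q : ℚ, alphaFun c r = (q : ℝ) * Real.pi}.Countable ∧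
    Set.Ioo R 1 ⊆
      closure {r | r ∈ Set.Ioo R 1 ∧ ∃ q : ℚ, alphaFun c r = (q : ℝ) * Real.pi} := by
  refine aux_final R hR1 (alphaFun c) ?_ hccc
  intro r hr
  obtain ⟨c', K, hc, hK⟩ := hC11
  obtain ⟨r0, h0, h1⟩ := exists_between hr.1
  have hr0 : 0 < r0 := hR0.trans_lt h0
  have hsub : Set.Icc r0 1 ⊆ Set.Icc R 1 := Set.Icc_subset_Icc_left h0.le
  refine aux_alpha_contDiffAt c c' r0 K hr0 (fun s hs => hpos s (hsub hs))
    (fun s hs => (hc s (hsub hs)).mono hsub) (hK.mono hsub) ?_ r ⟨h1, hr.2⟩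
  intro s hs
  have hsR := hsub hs
  have hcs := hpos s hsR
  have hH := hHerg s hsR
  have hd := (hasDerivWithinAt_id s (Set.Icc R 1)).div (hc s hsR) hcs.ne'
  have hu : UniqueDiffWithinAt ℝ (Set.Icc R 1) s := uniqueDiffOn_Icc hR1 s hsR
  have he : derivWithin (fun s => s / c s) (Set.Icc R 1) s = (1 * c s - id s * c' s) / c s ^ 2 :=
    hd.derivWithin hu
  rw [he] at hH
  have := (div_pos_iff_of_pos_right (by positivity)).1 hH
  simpa using this
end

section
/- Let c : [0,1] → (0,∞) be C^{1,1}, satisfy the Herglotz condition on (0,1], and satisfy c'(0) = 0. Then lim_{r → 0+} α(r) = π/2 and lim_{r → 0+} L(r) = ∫_0^1 c(r)^{-1} dr. -/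
open Set Filter Topology MeasureTheory

noncomputable def Qf (ρ : ℝ → ℝ) (r s : ℝ) : ℝ := (Real.sqrt (1 - (ρ r / ρ s) ^ 2))⁻¹

lemma core (ρ g : ℝ → ℝ) (r : ℝ) (h1 : r < 1) (hρr : 0 < ρ r)
    (hc : ContinuousOn ρ (Icc r 1)) (hg : ContinuousOn g (Icc r 1))
    (hgpos : ∀ s ∈ Icc r 1, 0 < g s)
    (hd : ∀ s ∈ Ioo r 1, HasDerivAt ρ (g s) s) :
    (∀ s ∈ Icc r 1, ρ r ≤ ρ s) ∧ (∀ s ∈ Ioc r 1, 1 ≤ Qf ρ r s) ∧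
    IntervalIntegrable (Qf ρ r) volume r 1 ∧
    ∫ s in r..1, g s * Qf ρ r s = Real.sqrt (ρ 1 ^ 2 - ρ r ^ 2) ∧
    ∫ s in r..1, g s = ρ 1 - ρ r ∧
    ∫ s in r..1, (ρ r * g s / ρ s ^ 2) * Qf ρ r s = Real.arccos (ρ r / ρ 1) := by
  have hle : r ≤ 1 := h1.le
  have hu : uIcc r 1 = Icc r 1 := uIcc_of_le hle
  have hmono : StrictMonoOn ρ (Icc r 1) := by
    apply strictMonoOn_of_deriv_pos (convex_Icc _ _) hc
    intro x hx
    rw [interior_Icc] at hx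
    rw [(hd x hx).deriv]
    exact hgpos x ⟨hx.1.le, hx.2.le⟩
  have hr : r ∈ Icc r 1 := ⟨le_rfl, hle⟩
  have hge : ∀ s ∈ Icc r 1, ρ r ≤ ρ s := fun s hs => hmono.monotoneOn hr hs hs.1
  have hgt : ∀ s ∈ Ioc r 1, ρ r < ρ s := fun s hs => hmono hr ⟨hs.1.le, hs.2⟩ hs.1
  have hpos : ∀ s ∈ Icc r 1, 0 < ρ s := fun s hs => hρr.trans_le (hge s hs)
  have hin : ∀ s ∈ Ioc r 1, 0 < 1 - (ρ r / ρ s) ^ 2 := by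
    intro s hs
    have h0 := hgt s hs
    have hp : 0 < ρ s := hρr.trans h0
    have : ρ r / ρ s < 1 := (div_lt_one hp).2 h0
    have h2 : 0 < ρ r / ρ s := by positivity
    nlinarith
  have hQ1 : ∀ s ∈ Ioc r 1, 1 ≤ Qf ρ r s := by
    intro s hs
    unfold Qf
    apply (one_le_inv₀ (Real.sqrt_pos.2 (hin s hs))).2
    rw [Real.sqrt_le_one]
    nlinarith [sq_nonneg (ρ r / ρ s)]
  have hGc : ContinuousOn (fun s => Real.sqrt (ρ s ^ 2 - ρ r ^ 2)) (Icc r 1) := by fun_prop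
  have hGd : ∀ s ∈ Ioo r 1, HasDerivAt (fun s => Real.sqrt (ρ s ^ 2 - ρ r ^ 2))
      (g s * Qf ρ r s) s := by
    intro s hs
    have h0 := hgt s ⟨hs.1, hs.2.le⟩
    have hp : 0 < ρ s := hρr.trans h0
    have hne : 0 < ρ s ^ 2 - ρ r ^ 2 := by nlinarith
    have := (((hd s hs).pow 2).sub_const (ρ r ^ 2)).sqrt hne.ne'
    refine this.congr_deriv ?_
    unfold Qf
    have e : 1 - (ρ r / ρ s) ^ 2 = (ρ s ^ 2 - ρ r ^ 2) / ρ s ^ 2 := by field_simp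
    rw [e, Real.sqrt_div hne.le, Real.sqrt_sq hp.le]
    have := (Real.sqrt_pos.2 hne).ne'
    simp
    field_simp
  have hGi : IntervalIntegrable (fun s => g s * Qf ρ r s) volume r 1 := by
    rw [intervalIntegrable_iff_integrableOn_Ioc_of_le hle]
    apply intervalIntegral.integrableOn_deriv_of_nonneg hGc hGd
    intro s hs
    exact mul_nonneg (hgpos s ⟨hs.1.le, hs.2.le⟩).le
      (zero_le_one.trans (hQ1 s ⟨hs.1, hs.2.le⟩))
  have hQi : IntervalIntegrable (Qf ρ r) volume r 1 := by
    have hinv : ContinuousOn (fun s => (g s)⁻¹) (uIcc r 1) := by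
      rw [hu]; exact hg.inv₀ (fun s hs => (hgpos s hs).ne')
    refine (hGi.continuousOn_mul hinv).congr ?_
    intro s hs
    rw [uIoc_of_le hle] at hs
    have := (hgpos s ⟨hs.1.le, hs.2⟩).ne'
    simp only
    field_simp
  refine ⟨hge, hQ1, hQi, ?_, ?_, ?_⟩
  · rw [intervalIntegral.integral_eq_sub_of_hasDerivAt_of_le hle hGc hGd hGi]
    simp
  · apply intervalIntegral.integral_eq_sub_of_hasDerivAt_of_le hle hc hd
    exact ContinuousOn.intervalIntegrable (by rwa [hu])
  · have hAc : ContinuousOn (fun s => Real.arccos (ρ r / ρ s)) (Icc r 1) :=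
      Real.continuous_arccos.comp_continuousOn
        (continuousOn_const.div hc (fun s hs => (hpos s hs).ne'))
    have hAd : ∀ s ∈ Ioo r 1, HasDerivAt (fun s => Real.arccos (ρ r / ρ s))
        ((ρ r * g s / ρ s ^ 2) * Qf ρ r s) s := by
      intro s hs
      have h0 := hgt s ⟨hs.1, hs.2.le⟩
      have hp : 0 < ρ s := hρr.trans h0
      have hlt : ρ r / ρ s < 1 := (div_lt_one hp).2 h0
      have hq : 0 < ρ r / ρ s := by positivity
      have h3 := (Real.hasDerivAt_arccos (x := ρ r / ρ s) (by linarith) (by linarith))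
      have h4 := (hasDerivAt_const s (ρ r)).div (hd s hs) hp.ne'
      have := h3.comp s h4
      refine this.congr_deriv ?_
      unfold Qf
      ring
    rw [intervalIntegral.integral_eq_sub_of_hasDerivAt_of_le hle hAc hAd]
    · simp [div_self hρr.ne']
    · apply hQi.continuousOn_mul
      rw [hu]
      exact (continuousOn_const.mul hg).div (hc.pow 2) (fun s hs => (pow_pos (hpos s hs) 2).ne')

theorem stmt5 (c : ℝ → ℝ) (c' : ℝ → ℝ) (K : NNReal)
    (hpos : ∀ r ∈ Set.Icc (0:ℝ) 1, 0 < c r)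
    (hderiv : ∀ r ∈ Set.Icc (0:ℝ) 1, HasDerivWithinAt c (c' r) (Set.Icc (0:ℝ) 1) r)
    (hlip : LipschitzOnWith K c' (Set.Icc (0:ℝ) 1))
    (hHerg : ∀ r ∈ Set.Ioc (0:ℝ) 1,
      0 < derivWithin (fun s => s / c s) (Set.Icc (0:ℝ) 1) r)
    (hc'0 : c' 0 = 0) :
    Filter.Tendsto (alphaFun c) (nhdsWithin 0 (Set.Ioo (0:ℝ) 1)) (nhds (Real.pi / 2)) ∧
    Filter.Tendsto (Lfun c) (nhdsWithin 0 (Set.Ioo (0:ℝ) 1))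
      (nhds (∫ r in (0:ℝ)..1, (c r)⁻¹)) := by
  have h0m : (0:ℝ) ∈ Icc (0:ℝ) 1 := ⟨le_rfl, zero_le_one⟩
  have h1m : (1:ℝ) ∈ Icc (0:ℝ) 1 := ⟨zero_le_one, le_rfl⟩
  have hcc : ContinuousOn c (Icc 0 1) := fun s hs => (hderiv s hs).continuousWithinAt
  have hc'c : ContinuousOn c' (Icc 0 1) := hlip.continuousOn
  have hne : ∀ s ∈ Icc (0:ℝ) 1, c s ≠ 0 := fun s hs => (hpos s hs).ne'
  have hc'b : ∀ s ∈ Icc (0:ℝ) 1, |c' s| ≤ K * s := by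
    intro s hs
    have := hlip.dist_le_mul s hs 0 h0m
    simpa [Real.dist_eq, hc'0, abs_of_nonneg hs.1] using this
  set ρ : ℝ → ℝ := fun s => s / c s with hρ
  set g : ℝ → ℝ := fun s => (c s - s * c' s) / c s ^ 2 with hg
  have hρd : ∀ s ∈ Icc (0:ℝ) 1, HasDerivWithinAt ρ (g s) (Icc 0 1) s := by
    intro s hs
    have := (hasDerivWithinAt_id s (Icc (0:ℝ) 1)).div (hderiv s hs) (hne s hs)
    refine this.congr_deriv ?_
    simp only [hg, id, one_mul]
  have hρc : ContinuousOn ρ (Icc 0 1) := fun s hs => (hρd s hs).continuousWithinAt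
  have hgc : ContinuousOn g (Icc 0 1) :=
    (hcc.sub (continuousOn_id.mul hc'c)).div (hcc.pow 2) (fun s hs => pow_ne_zero 2 (hne s hs))
  have hgpos : ∀ s ∈ Icc (0:ℝ) 1, 0 < g s := by
    intro s hs
    rcases eq_or_lt_of_le hs.1 with h | h
    · subst h
      have := hpos 0 h0m
      simp only [hg]
      rw [zero_mul, sub_zero]; positivity
    · have := hHerg s ⟨h, hs.2⟩
      rwa [(hρd s hs).derivWithin (uniqueDiffOn_Icc zero_lt_one s hs)] at this
  obtain ⟨D, hD⟩ := isCompact_Icc.exists_bound_of_continuousOn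
    (hgc.inv₀ (fun s hs => (hgpos s hs).ne'))
  obtain ⟨B, hB⟩ := isCompact_Icc.exists_bound_of_continuousOn (hcc.inv₀ hne)
  have hDg : ∀ s ∈ Icc (0:ℝ) 1, 1 ≤ D * g s := by
    intro s hs
    have h := (le_abs_self _).trans (hD s hs)
    have hp := hgpos s hs
    calc 1 = (g s)⁻¹ * g s := by field_simp
      _ ≤ D * g s := by gcongr; exact h
  have hBc : ∀ s ∈ Icc (0:ℝ) 1, (c s)⁻¹ ≤ B := fun s hs => (le_abs_self _).trans (hB s hs)
  have hD0 : 0 ≤ D := (norm_nonneg _).trans (hD 0 h0m)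
  have hB0 : 0 ≤ B := (norm_nonneg _).trans (hB 0 h0m)
  have hρ0 : ρ 0 = 0 := by simp [hρ]
  have hρ1 : 0 < ρ 1 := by have := hpos 1 h1m; simp only [hρ]; positivity
  have hρt : Tendsto ρ (𝓝[Ioo 0 1] 0) (𝓝 0) := by
    have := (hρc 0 h0m).mono_left (nhdsWithin_mono 0 Ioo_subset_Icc_self)
    rwa [hρ0] at this
  have hidt : Tendsto (fun r : ℝ => r) (𝓝[Ioo 0 1] (0:ℝ)) (𝓝 0) :=
    tendsto_id.mono_left nhdsWithin_le_nhds
  have hsub : ∀ r ∈ Ioo (0:ℝ) 1, Icc r 1 ⊆ Icc 0 1 := fun r hr => Icc_subset_Icc_left hr.1.le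
  have hρp : ∀ r ∈ Ioo (0:ℝ) 1, 0 < ρ r := by
    intro r hr
    have := hpos r ⟨hr.1.le, hr.2.le⟩
    have := hr.1
    simp only [hρ]; positivity
  have hcore := fun r (hr : r ∈ Ioo (0:ℝ) 1) => core ρ g r hr.2 (hρp r hr)
    (hρc.mono (hsub r hr)) (hgc.mono (hsub r hr)) (fun s hs => hgpos s (hsub r hr hs))
    (fun s hs => (hρd s ⟨hr.1.le.trans hs.1.le, hs.2.le⟩).hasDerivAt
      (Icc_mem_nhds (hr.1.trans hs.1) hs.2))
  have hQeq : ∀ r s, (Real.sqrt (1 - (r * c s / (s * c r)) ^ 2))⁻¹ = Qf ρ r s := by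
    intro r s
    simp only [Qf, hρ]
    rw [div_div_div_eq, mul_comm (c r) s]
  have hsq : ∀ r ∈ Ioo (0:ℝ) 1, Real.sqrt (ρ 1 ^ 2 - ρ r ^ 2) ≤ ρ 1 := by
    intro r hr
    apply Real.sqrt_le_iff.2 ⟨hρ1.le, by nlinarith [sq_nonneg (ρ r)]⟩
  constructor
  · have hmain : ∀ r ∈ Ioo (0:ℝ) 1,
        |alphaFun c r - Real.arccos (ρ r / ρ 1)| ≤ ρ r * (K * D * ρ 1) := by
      intro r hr
      obtain ⟨-, hQ1, hQi, hI1, hI2, hI3⟩ := hcore r hr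
      have hu : uIcc r 1 = Icc r 1 := uIcc_of_le hr.2.le
      have hs0 : ∀ s ∈ Icc r 1, s ≠ 0 := fun s hs => (hr.1.trans_le hs.1).ne'
      have hcr : ContinuousOn c (uIcc r 1) := by rw [hu]; exact hcc.mono (hsub r hr)
      have hgr : ContinuousOn g (uIcc r 1) := by rw [hu]; exact hgc.mono (hsub r hr)
      have hρr : ContinuousOn ρ (uIcc r 1) := by rw [hu]; exact hρc.mono (hsub r hr)
      have hcrp := hpos r ⟨hr.1.le, hr.2.le⟩
      have hi1 : IntervalIntegrable (fun s => (r * c s) / (c r * s ^ 2) * Qf ρ r s) volume r 1 := by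
        apply hQi.continuousOn_mul
        refine (continuousOn_const.mul hcr).div (by fun_prop) ?_
        intro s hs
        rw [hu] at hs
        exact mul_ne_zero hcrp.ne' (pow_ne_zero 2 (hs0 s hs))
      have hi2 : IntervalIntegrable (fun s => (ρ r * g s / ρ s ^ 2) * Qf ρ r s) volume r 1 := by
        apply hQi.continuousOn_mul
        refine (continuousOn_const.mul hgr).div (hρr.pow 2) ?_
        intro s hs
        rw [hu] at hs
        exact pow_ne_zero 2 (div_ne_zero (hs0 s hs) (hne s (hsub r hr hs)))
      have hi3 : IntervalIntegrable (fun s => (ρ r * K * D) * (g s * Qf ρ r s)) volume r 1 :=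
        (hQi.continuousOn_mul hgr).const_mul _
      unfold alphaFun
      simp only [hQeq]
      rw [← hI3, ← intervalIntegral.integral_sub hi1 hi2, ← Real.norm_eq_abs]
      calc _ ≤ ∫ s in r..1, (ρ r * K * D) * (g s * Qf ρ r s) := by
            apply intervalIntegral.norm_integral_le_of_norm_le hr.2.le _ hi3
            refine Eventually.of_forall fun s hs => ?_
            have hsI : s ∈ Icc r 1 := ⟨hs.1.le, hs.2⟩
            have hcs := hpos s (hsub r hr hsI)
            have hsp : 0 < s := hr.1.trans hs.1
            have hQp := zero_le_one.trans (hQ1 s hs)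
            have e : (r * c s) / (c r * s ^ 2) * Qf ρ r s - (ρ r * g s / ρ s ^ 2) * Qf ρ r s
              = ρ r * (c' s / s) * Qf ρ r s := by
              simp only [hρ, hg]
              field_simp
              ring
            rw [e, Real.norm_eq_abs, abs_mul, abs_mul, abs_of_nonneg hQp, abs_of_pos (hρp r hr),
              abs_div, abs_of_pos hsp]
            have h1 : |c' s| / s ≤ K := (div_le_iff₀ hsp).2 (hc'b s (hsub r hr hsI))
            have h2 := hDg s (hsub r hr hsI)
            have h3 := (hρp r hr).le
            calc ρ r * (|c' s| / s) * Qf ρ r s ≤ ρ r * K * Qf ρ r s := by gcongr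
              _ = ρ r * K * Qf ρ r s * 1 := by ring
              _ ≤ ρ r * K * Qf ρ r s * (D * g s) := by gcongr
              _ = _ := by ring
        _ = (ρ r * K * D) * Real.sqrt (ρ 1 ^ 2 - ρ r ^ 2) := by
            rw [intervalIntegral.integral_const_mul, hI1]
        _ ≤ (ρ r * K * D) * ρ 1 := by
            have h3 := (hρp r hr).le
            have := hsq r hr
            gcongr
        _ = _ := by ring
    have ht1 : Tendsto (fun r => Real.arccos (ρ r / ρ 1)) (𝓝[Ioo 0 1] 0) (𝓝 (Real.pi / 2)) := by
      have := (Real.continuous_arccos.tendsto (0 / ρ 1)).comp (hρt.div_const (ρ 1))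
      rw [zero_div, Real.arccos_zero] at this
      exact this
    have ht2 : Tendsto (fun r => alphaFun c r - Real.arccos (ρ r / ρ 1)) (𝓝[Ioo 0 1] 0) (𝓝 0) := by
      apply squeeze_zero_norm' (a := fun r => ρ r * (K * D * ρ 1))
      · filter_upwards [self_mem_nhdsWithin] with r hr using hmain r hr
      · simpa using hρt.mul_const (K * D * ρ 1)
    simpa using ht2.add ht1
  · have hmain : ∀ r ∈ Ioo (0:ℝ) 1,
        |Lfun c r - ∫ s in (0:ℝ)..1, (c s)⁻¹| ≤ B * D * ρ r + B * r := by
      intro r hr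
      obtain ⟨-, hQ1, hQi, hI1, hI2, hI3⟩ := hcore r hr
      have hu : uIcc r 1 = Icc r 1 := uIcc_of_le hr.2.le
      have hcr : ContinuousOn (fun s => (c s)⁻¹) (uIcc r 1) := by
        rw [hu]; exact (hcc.inv₀ hne).mono (hsub r hr)
      have hc0 : ContinuousOn (fun s => (c s)⁻¹) (uIcc 0 r) := by
        rw [uIcc_of_le hr.1.le]
        exact (hcc.inv₀ hne).mono (Icc_subset_Icc_right hr.2.le)
      have hgr : ContinuousOn g (uIcc r 1) := by rw [hu]; exact hgc.mono (hsub r hr)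
      have hi1 := hQi.continuousOn_mul hcr
      have hi2 := hcr.intervalIntegrable (μ := volume)
      have hi3 := hQi.continuousOn_mul hgr
      have hi4 := hgr.intervalIntegrable (μ := volume)
      have hi5 := hc0.intervalIntegrable (μ := volume)
      have hA : |(∫ s in r..1, (c s)⁻¹ * Qf ρ r s) - ∫ s in r..1, (c s)⁻¹| ≤ B * D * ρ r := by
        rw [← intervalIntegral.integral_sub hi1 hi2, ← Real.norm_eq_abs]
        calc _ ≤ ∫ s in r..1, (B * D) * (g s * Qf ρ r s - g s) := by
              apply intervalIntegral.norm_integral_le_of_norm_le hr.2.le _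
                ((hi3.sub hi4).const_mul _)
              refine Eventually.of_forall fun s hs => ?_
              have hsI := hsub r hr ⟨hs.1.le, hs.2⟩
              have hcs := hpos s hsI
              have hQ : 0 ≤ Qf ρ r s - 1 := sub_nonneg.2 (hQ1 s hs)
              have e : (c s)⁻¹ * Qf ρ r s - (c s)⁻¹ = (c s)⁻¹ * (Qf ρ r s - 1) := by ring
              rw [e, Real.norm_eq_abs, abs_of_nonneg (by positivity)]
              have h1 := hBc s hsI
              have h2 := hDg s hsI
              calc (c s)⁻¹ * (Qf ρ r s - 1) ≤ B * (Qf ρ r s - 1) * 1 := by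
                    rw [mul_one]; gcongr
                _ ≤ B * (Qf ρ r s - 1) * (D * g s) := by gcongr
                _ = _ := by ring
          _ = (B * D) * (Real.sqrt (ρ 1 ^ 2 - ρ r ^ 2) - (ρ 1 - ρ r)) := by
              rw [intervalIntegral.integral_const_mul, intervalIntegral.integral_sub hi3 hi4,
                hI1, hI2]
          _ ≤ (B * D) * ρ r := by
              have := hsq r hr
              gcongr
              linarith
      have hBd : |∫ s in (0:ℝ)..r, (c s)⁻¹| ≤ B * r := by
        have := intervalIntegral.norm_integral_le_of_norm_le_const (a := 0) (b := r)
          (f := fun s => (c s)⁻¹) (C := B) (by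
            intro s hs
            rw [uIoc_of_le hr.1.le] at hs
            exact hB s ⟨hs.1.le, hs.2.trans hr.2.le⟩)
        simpa [abs_of_pos hr.1] using this
      unfold Lfun
      simp only [hQeq]
      rw [← intervalIntegral.integral_add_adjacent_intervals hi5 hi2]
      rw [abs_le] at *
      constructor <;> linarith [hA.1, hA.2, hBd.1, hBd.2]
    rw [tendsto_iff_norm_sub_tendsto_zero]
    apply squeeze_zero' (g := fun r => B * D * ρ r + B * r)
    · exact Eventually.of_forall fun _ => norm_nonneg _
    · filter_upwards [self_mem_nhdsWithin] with r hr using hmain r hr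
    · simpa using (hρt.const_mul (B * D)).add (hidt.const_mul B)
end

section
/- Let 0 ≤ R < 1 and let c : [R,1] → (0,∞) be C^{1,1}, satisfy the Herglotz condition, and satisfy the countable conjugacy condition. Then the set S = {r ∈ (R,1) : α(r) ∈ π·ℚ and α'(r) ≠ 0} is countable and dense in (R,1). -/
namespace Aux7
open Set Filter Topology MeasureTheory

lemma aux_countable (f : ℝ → ℝ) (y : ℝ) : {x | f x = y ∧ deriv f x ≠ 0}.Countable := by
  set s := {x | f x = y ∧ deriv f x ≠ 0} with hs
  refine (countable_setOfPred_isolated_right_within (s := s)).mono ?_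
  intro x hx
  refine ⟨hx, ?_⟩
  have hd : HasDerivAt f (deriv f x) x :=
    (differentiableAt_of_deriv_ne_zero hx.2).hasDerivAt
  have h1 := hd.eventually_ne (c := y) hx.2
  rw [← Filter.empty_mem_iff_bot]
  have h2 : ∀ᶠ z in 𝓝[s ∩ Ioi x] x, f z ≠ y := by
    refine h1.filter_mono (nhdsWithin_mono _ ?_)
    intro z hz
    exact (ne_of_gt hz.2)
  filter_upwards [h2, self_mem_nhdsWithin] with z hz hz2
  exact hz hz2.1.1

/-- Points from which all short right slopes are bounded below. -/
def slopeSet (f : ℝ → ℝ) (a b : ℝ) (n : ℕ) : Set ℝ :=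
  {x | x ∈ Icc a b ∧ ∀ y ∈ Icc a b, (y ≤ x ∨ x + 1 / (n + 1 : ℝ) ≤ y) ∨
    (y - x) / (n + 1 : ℝ) ≤ f y - f x}

lemma slopeSet_closed (f : ℝ → ℝ) (a b : ℝ) (n : ℕ) (hf : ContinuousOn f (Icc a b)) :
    IsClosed (slopeSet f a b n) := by
  have : slopeSet f a b n = Icc a b ∩ ⋂ y ∈ Icc a b, (Icc a b ∩ {x | y ≤ x ∨ x + 1 / (n + 1 : ℝ) ≤ y}) ∪
      (Icc a b ∩ (fun x => f y - f x - (y - x) / (n + 1 : ℝ)) ⁻¹' Ici 0) := by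
    ext x
    simp only [slopeSet, mem_ofPred_eq, mem_inter_iff, mem_iInter, mem_union, mem_preimage, mem_Ici,
      sub_nonneg]
    constructor
    · rintro ⟨h1, h2⟩
      exact ⟨h1, fun y hy => (h2 y hy).imp (fun h => ⟨h1, h⟩) (fun h => ⟨h1, h⟩)⟩
    · rintro ⟨h1, h2⟩
      exact ⟨h1, fun y hy => (h2 y hy).imp (fun h => h.2) (fun h => h.2)⟩
  rw [this]
  refine isClosed_Icc.inter (isClosed_biInter fun y _ => ?_)
  refine IsClosed.union ?_ ?_
  · refine isClosed_Icc.inter ?_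
    exact (isClosed_le continuous_const continuous_id).union
      (isClosed_le (f := fun x : ℝ => x + 1 / (n + 1 : ℝ)) (by fun_prop) continuous_const)
  · refine ContinuousOn.preimage_isClosed_of_isClosed ?_ isClosed_Icc isClosed_Ici
    fun_prop

lemma slopeSet_mem (f : ℝ → ℝ) (a b x f' : ℝ) (hx : x ∈ Icc a b) (hf : HasDerivAt f f' x)
    (hpos : 0 < f') : ∃ n, x ∈ slopeSet f a b n := by
  have h1 : ∀ᶠ y in 𝓝[>] x, f' / 2 < slope f x y := by
    have := hasDerivAt_iff_tendsto_slope.1 hf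
    have h2 := this.eventually (lt_mem_nhds (half_lt_self hpos))
    exact h2.filter_mono (nhdsWithin_mono _ (fun z hz => ne_of_gt hz))
  obtain ⟨u, hu, hu2⟩ := mem_nhdsGT_iff_exists_Ioo_subset.1 h1
  have hu' : (0:ℝ) < min (u - x) (f' / 2) := lt_min (sub_pos.2 hu) (half_pos hpos)
  obtain ⟨n, hn⟩ := exists_nat_one_div_lt hu'
  refine ⟨n, hx, fun y hy => ?_⟩
  by_cases h : y ≤ x ∨ x + 1 / (n + 1 : ℝ) ≤ y
  · exact Or.inl h
  · right
    push Not at h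
    have h3 : y ∈ Ioo x u := ⟨h.1, by have := min_le_left (u - x) (f' / 2); linarith⟩
    have h4 : f' / 2 < slope f x y := hu2 h3
    rw [slope_def_field, lt_div_iff₀ (sub_pos.2 h.1)] at h4
    have h5 : 1 / (n + 1 : ℝ) ≤ f' / 2 := (hn.trans_le (min_le_right _ _)).le
    have h6 := mul_le_mul_of_nonneg_right h5 (sub_pos.2 h.1).le
    rw [div_eq_mul_one_div, mul_comm]
    linarith

lemma slopeSet_deriv (f : ℝ → ℝ) (a b x f' : ℝ) (n : ℕ) (hx : x ∈ Ioo a b)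
    (hxs : x ∈ slopeSet f a b n) (hf : HasDerivAt f f' x) : 0 < f' := by
  have hn : (0:ℝ) < 1 / (n + 1 : ℝ) := by positivity
  have h0 : Tendsto (slope f x) (𝓝[>] x) (𝓝 f') :=
    (hasDerivAt_iff_tendsto_slope.1 hf).mono_left (nhdsWithin_mono _ (fun z hz => ne_of_gt hz))
  refine lt_of_lt_of_le hn (ge_of_tendsto h0 ?_)
  have h1 : Ioo x (min b (x + 1 / (n + 1 : ℝ))) ∈ 𝓝[>] x :=
    Ioo_mem_nhdsGT (lt_min hx.2 (by linarith))
  filter_upwards [h1] with y hy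
  have hy1 := hy.1
  have hy2 := lt_min_iff.1 hy.2
  rcases hxs.2 y ⟨by linarith [hx.1], hy2.1.le⟩ with h | h
  · rcases h with h | h <;> linarith
  · rw [slope_def_field, le_div_iff₀ (sub_pos.2 hy1)]
    rw [div_eq_mul_one_div, mul_comm] at h
    exact h

lemma aux_baire (f : ℝ → ℝ) (a b : ℝ) (hab : a < b) (hf : ∀ x ∈ Icc a b, DifferentiableAt ℝ f x)
    (hc : {x | x ∈ Icc a b ∧ deriv f x = 0}.Countable) :
    ∃ u v, u < v ∧ Icc u v ⊆ Ioo a b ∧ ∀ x ∈ Icc u v, deriv f x ≠ 0 := by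
  set Z := {x | x ∈ Icc a b ∧ deriv f x = 0} with hZ
  have : Countable Z := hc.to_subtype
  have hfc : ContinuousOn f (Icc a b) := fun x hx => (hf x hx).continuousAt.continuousWithinAt
  let F : (ℕ ⊕ ℕ) ⊕ (Z ⊕ Bool) → Set ℝ := Sum.elim
    (Sum.elim (slopeSet f a b) (slopeSet (fun x => - f x) a b))
    (Sum.elim (fun z => {z.1}) (fun t => if t then Iic a else Ici b))
  have hcl : ∀ i, IsClosed (F i) := by
    rintro ((n | n) | (z | t))
    · exact slopeSet_closed f a b n hfc
    · exact slopeSet_closed _ a b n hfc.neg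
    · exact isClosed_singleton
    · cases t
      · simpa [F] using isClosed_Ici
      · simpa [F] using isClosed_Iic
  have hU : ⋃ i, F i = univ := by
    refine eq_univ_of_forall fun x => ?_
    rw [mem_iUnion]
    by_cases hxa : x ≤ a
    · exact ⟨Sum.inr (Sum.inr true), by simpa [F] using hxa⟩
    by_cases hxb : b ≤ x
    · exact ⟨Sum.inr (Sum.inr false), by simpa [F] using hxb⟩
    push Not at hxa hxb
    have hx : x ∈ Icc a b := ⟨hxa.le, hxb.le⟩
    have hd := (hf x hx).hasDerivAt
    rcases lt_trichotomy (deriv f x) 0 with h | h | h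
    · obtain ⟨n, hn⟩ := slopeSet_mem (fun x => - f x) a b x _ hx hd.neg (by linarith)
      exact ⟨Sum.inl (Sum.inr n), hn⟩
    · exact ⟨Sum.inr (Sum.inl ⟨x, hx, h⟩), by simp [F]⟩
    · obtain ⟨n, hn⟩ := slopeSet_mem f a b x _ hx hd h
      exact ⟨Sum.inl (Sum.inl n), hn⟩
  have hD := dense_iUnion_interior_of_closed hcl hU
  obtain ⟨x, hx, hxi⟩ := hD.exists_mem_open isOpen_Ioo (nonempty_Ioo.2 hab)
  obtain ⟨i, hi⟩ := mem_iUnion.1 hx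
  have hnh : interior (F i) ∩ Ioo a b ∈ 𝓝 x :=
    (isOpen_interior.inter isOpen_Ioo).mem_nhds ⟨hi, hxi⟩
  obtain ⟨ε, hε, hε2⟩ := Metric.nhds_basis_closedBall.mem_iff.1 hnh
  rw [Real.closedBall_eq_Icc] at hε2
  refine ⟨x - ε, x + ε, by linarith, fun y hy => (hε2 hy).2, ?_⟩
  intro y hy
  have hyi := interior_subset (hε2 hy).1
  have hyI := (hε2 hy).2
  have hd := (hf y (Ioo_subset_Icc_self hyI)).hasDerivAt
  rcases i with ((n | n) | (z | t))
  · exact (slopeSet_deriv f a b y _ n hyI hyi hd).ne'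
  · have := slopeSet_deriv _ a b y _ n hyI hyi hd.neg
    intro h; linarith
  · exfalso
    have e1 : x - ε ∈ F (Sum.inr (Sum.inl z)) :=
      interior_subset (hε2 ⟨by linarith, by linarith⟩).1
    have e2 : x ∈ F (Sum.inr (Sum.inl z)) :=
      interior_subset (hε2 ⟨by linarith, by linarith⟩).1
    simp only [F, Sum.elim_inr, Sum.elim_inl, mem_singleton_iff] at e1 e2
    linarith
  · exfalso
    cases t
    · simp [F] at hyi; linarith [hyI.2]
    · simp [F] at hyi; linarith [hyI.1]

lemma aux_dense (f : ℝ → ℝ) (R : ℝ) (hf : ∀ x ∈ Ioo R 1, DifferentiableAt ℝ f x)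
    (hc : {x | x ∈ Ioo R 1 ∧ deriv f x = 0}.Countable) :
    Ioo R 1 ⊆ closure {r | r ∈ Ioo R 1 ∧
        (∃ q : ℚ, f r = (q : ℝ) * Real.pi) ∧ deriv f r ≠ 0} := by
  intro x hx
  rw [mem_closure_iff_nhds]
  intro t ht
  obtain ⟨ε, hε, hε2⟩ := Metric.nhds_basis_closedBall.mem_iff.1 (inter_mem ht (isOpen_Ioo.mem_nhds hx))
  rw [Real.closedBall_eq_Icc] at hε2
  obtain ⟨u, v, huv, hI, hne⟩ := aux_baire f (x - ε) (x + ε) (by linarith)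
    (fun y hy => hf y (hε2 hy).2) (hc.mono fun y (hy : y ∈ Icc (x - ε) (x + ε) ∧ deriv f y = 0) =>
      show y ∈ Ioo R 1 ∧ deriv f y = 0 from ⟨(hε2 hy.1).2, hy.2⟩)
  have hcont : ContinuousOn f (Icc u v) := fun y hy =>
    (hf y (hε2 (Ioo_subset_Icc_self (hI hy))).2).continuousAt.continuousWithinAt
  have huv' : f u ≠ f v := by
    intro h
    obtain ⟨z, hz, hz2⟩ := exists_deriv_eq_zero huv hcont h
    exact hne z (Ioo_subset_Icc_self hz) hz2
  have hpi := Real.pi_pos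
  have hlt : min (f u) (f v) / Real.pi < max (f u) (f v) / Real.pi :=
    div_lt_div_of_pos_right (min_lt_max.2 huv') hpi
  obtain ⟨q, hq1, hq2⟩ := exists_rat_btwn hlt
  rw [div_lt_iff₀ hpi] at hq1
  rw [lt_div_iff₀ hpi] at hq2
  have hiv := intermediate_value_uIcc (a := u) (b := v) (f := f) (by rwa [uIcc_of_le huv.le])
  obtain ⟨z, hz, hz2⟩ := hiv (show (q : ℝ) * Real.pi ∈ uIcc (f u) (f v) from Set.mem_Icc.2 ⟨hq1.le, hq2.le⟩)
  rw [uIcc_of_le huv.le] at hz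
  have hz3 := hε2 (Ioo_subset_Icc_self (hI hz))
  exact ⟨z, hz3.1, hz3.2, ⟨q, hz2⟩, hne z hz⟩

/-! ### differentiability of the parametric integral -/

lemma sqrt_lip (p q t : ℝ) : |√(p ^ 2 + t ^ 2) - √(q ^ 2 + t ^ 2)| ≤ |p - q| := by
  have ha := Real.sq_sqrt (show 0 ≤ p ^ 2 + t ^ 2 by positivity)
  have hb := Real.sq_sqrt (show 0 ≤ q ^ 2 + t ^ 2 by positivity)
  have hcs : p * q + t ^ 2 ≤ √(p ^ 2 + t ^ 2) * √(q ^ 2 + t ^ 2) := by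
    rw [← Real.sqrt_mul (by positivity)]
    apply Real.le_sqrt_of_sq_le
    nlinarith [sq_nonneg (t * (p - q))]
  apply sq_le_sq.1
  nlinarith

lemma aux_param (h : ℝ → ℝ) (K : NNReal) (hh : LipschitzWith K h) (B p₀ : ℝ) (hB : 0 ≤ B) (hp : 0 < p₀) :
    DifferentiableAt ℝ (fun p => ∫ t in (0:ℝ)..B, h (√(p ^ 2 + t ^ 2))) p₀ := by
  have hN : volume {u | ¬ DifferentiableAt ℝ h u} = 0 := hh.ae_differentiableAt_real
  have hN2 : volume ((fun u => √(u ^ 2 - p₀ ^ 2)) '' ({u | ¬ DifferentiableAt ℝ h u} ∩ Ioi p₀)) = 0 := by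
    apply addHaar_image_eq_zero_of_differentiableOn_of_addHaar_eq_zero
    · intro u hu
      have hu2 : p₀ < u := hu.2
      have : u ^ 2 - p₀ ^ 2 ≠ 0 := by nlinarith
      exact DifferentiableAt.differentiableWithinAt (DifferentiableAt.sqrt (by fun_prop) this)
    · exact measure_mono_null inter_subset_left hN
  have hsq : ∀ t, HasDerivAt (fun p : ℝ => √(p ^ 2 + t ^ 2)) (p₀ / √(p₀ ^ 2 + t ^ 2)) p₀ := by
    intro t
    have h1 : HasDerivAt (fun p : ℝ => p ^ 2 + t ^ 2) (2 * p₀) p₀ := by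
      simpa using (hasDerivAt_pow 2 p₀).add_const (t ^ 2)
    have h2 := h1.sqrt (by positivity)
    convert h2 using 1
    field_simp
  have hcont := hh.continuous
  have := intervalIntegral.hasDerivAt_integral_of_dominated_loc_of_lip (μ := volume) (a := 0) (b := B)
    (F := fun p t => h (√(p ^ 2 + t ^ 2)))
    (F' := fun t => deriv h (√(p₀ ^ 2 + t ^ 2)) * (p₀ / √(p₀ ^ 2 + t ^ 2))) (x₀ := p₀)
    (s := univ) (bound := fun _ => (K : ℝ)) univ_mem ?_ ?_ ?_ ?_ ?_ ?_
  · exact this.2.differentiableAt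
  · refine Eventually.of_forall fun p => Continuous.aestronglyMeasurable (by fun_prop)
  · exact Continuous.intervalIntegrable (by fun_prop) _ _
  · refine Measurable.aestronglyMeasurable ?_
    refine Measurable.mul ((measurable_deriv h).comp (by fun_prop)) (by fun_prop)
  · refine Eventually.of_forall fun t _ => ?_
    refine LipschitzOnWith.of_dist_le_mul fun p _ q _ => ?_
    refine (hh.dist_le_mul _ _).trans ?_
    simp only [Real.dist_eq, Real.coe_nnabs, NNReal.abs_eq]
    exact mul_le_mul_of_nonneg_left (sqrt_lip p q t) K.2
  · exact intervalIntegrable_const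
  · have : ∀ᵐ t ∂(volume : Measure ℝ), t ∉ ((fun u => √(u ^ 2 - p₀ ^ 2)) '' ({u | ¬ DifferentiableAt ℝ h u} ∩ Ioi p₀)) :=
      measure_eq_zero_iff_ae_notMem.1 hN2
    filter_upwards [this] with t ht htI
    rw [uIoc_of_le hB] at htI
    have hd : DifferentiableAt ℝ h (√(p₀ ^ 2 + t ^ 2)) := by
      by_contra hcon
      apply ht
      refine ⟨√(p₀ ^ 2 + t ^ 2), ⟨hcon, ?_⟩, ?_⟩
      · exact Real.lt_sqrt_of_sq_lt (by nlinarith [htI.1])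
      · simp only
        rw [Real.sq_sqrt (by positivity), add_sub_cancel_left, Real.sqrt_sq htI.1.le]
    exact hd.hasDerivAt.comp p₀ (hsq t)

/-! ### change of variables -/

lemma aux_cov (ρ ρ' G : ℝ → ℝ) (r : ℝ) (hr : r < 1) (hp : 0 < ρ r)
    (hcont : ContinuousOn ρ (Icc r 1)) (hder : ∀ s ∈ Ioo r 1, HasDerivAt ρ (ρ' s) s)
    (hpos : ∀ s ∈ Ioo r 1, 0 < ρ' s) (hmono : StrictMonoOn ρ (Icc r 1)) :
    ∫ t in (0:ℝ)..√(ρ 1 ^ 2 - ρ r ^ 2), G t =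
      ∫ s in r..1, ρ s * ρ' s / √(ρ s ^ 2 - ρ r ^ 2) * G (√(ρ s ^ 2 - ρ r ^ 2)) := by
  have hrm : r ∈ Icc r 1 := ⟨le_rfl, hr.le⟩
  have h1m : (1:ℝ) ∈ Icc r 1 := ⟨hr.le, le_rfl⟩
  set f : ℝ → ℝ := fun s => √(ρ s ^ 2 - ρ r ^ 2) with hf
  have hge : ∀ s ∈ Icc r 1, ρ r ≤ ρ s := fun s hs => hmono.monotoneOn hrm hs hs.1
  have hfm : StrictMonoOn f (Icc r 1) := by
    intro x hx y hy hxy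
    have h1 := hge x hx
    have h2 := hmono hx hy hxy
    apply Real.sqrt_lt_sqrt <;> nlinarith
  have hfc : ContinuousOn f (Icc r 1) := by
    apply ContinuousOn.sqrt
    fun_prop
  have hfr : f r = 0 := by simp [hf]
  have him : f '' Ioo r 1 = Ioo 0 (f 1) := by
    apply Subset.antisymm
    · rintro _ ⟨s, hs, rfl⟩
      refine ⟨?_, hfm (Ioo_subset_Icc_self hs) h1m hs.2⟩
      rw [← hfr]
      exact hfm hrm (Ioo_subset_Icc_self hs) hs.1
    · rw [← hfr]
      exact intermediate_value_Ioo hr.le hfc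
  have hd : ∀ s ∈ Ioo r 1, HasDerivAt f (ρ s * ρ' s / f s) s := by
    intro s hs
    have hlt := hmono hrm (Ioo_subset_Icc_self hs) hs.1
    have h1 : HasDerivAt (fun s => ρ s ^ 2 - ρ r ^ 2) (2 * ρ s * ρ' s) s := by
      simpa using ((hder s hs).pow 2).sub_const (ρ r ^ 2)
    have h2 := h1.sqrt (by nlinarith)
    convert h2 using 1
    simp only [hf]
    rw [mul_assoc, mul_div_mul_left _ _ two_ne_zero]
  have hcv := integral_image_eq_integral_abs_deriv_smul measurableSet_Ioo
    (fun s hs => (hd s hs).hasDerivWithinAt) (hfm.injOn.mono Ioo_subset_Icc_self) G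
  have h01 : 0 ≤ f 1 := Real.sqrt_nonneg _
  rw [show √(ρ 1 ^ 2 - ρ r ^ 2) = f 1 from rfl]
  rw [intervalIntegral.integral_of_le h01, intervalIntegral.integral_of_le hr.le,
    integral_Ioc_eq_integral_Ioo, integral_Ioc_eq_integral_Ioo, ← him, hcv]
  refine setIntegral_congr_fun measurableSet_Ioo fun s hs => ?_
  have h3 : 0 ≤ ρ s * ρ' s / f s := by
    have := hge s (Ioo_subset_Icc_self hs)
    have := hpos s hs
    have : 0 ≤ ρ s := by linarith
    have : 0 ≤ f s := Real.sqrt_nonneg _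
    positivity
  simp only [smul_eq_mul]
  rw [abs_of_nonneg h3]

/-! ### bounded Lipschitz functions -/

/-- bounded and Lipschitz on a set -/
def LB (f : ℝ → ℝ) (S : Set ℝ) : Prop :=
  ∃ M : ℝ, 0 ≤ M ∧ (∀ x ∈ S, |f x| ≤ M) ∧ ∀ x ∈ S, ∀ y ∈ S, |f x - f y| ≤ M * |x - y|

lemma LB.mul {f g : ℝ → ℝ} {S : Set ℝ} (hf : LB f S) (hg : LB g S) : LB (fun x => f x * g x) S := by
  obtain ⟨M, hM, h1, h2⟩ := hf
  obtain ⟨N, hN, h3, h4⟩ := hg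
  refine ⟨2 * (M * N), by positivity, fun x hx => ?_, fun x hx y hy => ?_⟩
  · rw [abs_mul]
    have := mul_le_mul (h1 x hx) (h3 x hx) (abs_nonneg _) hM
    have : 0 ≤ M * N := by positivity
    linarith
  · have e : f x * g x - f y * g y = f x * (g x - g y) + (f x - f y) * g y := by ring
    rw [e]
    refine (abs_add_le _ _).trans ?_
    rw [abs_mul, abs_mul]
    have a1 := mul_le_mul (h1 x hx) (h4 x hx y hy) (abs_nonneg _) hM
    have a2 := mul_le_mul (h2 x hx y hy) (h3 y hy) (abs_nonneg _) (by positivity)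
    linarith

lemma LB.sub {f g : ℝ → ℝ} {S : Set ℝ} (hf : LB f S) (hg : LB g S) : LB (fun x => f x - g x) S := by
  obtain ⟨M, hM, h1, h2⟩ := hf
  obtain ⟨N, hN, h3, h4⟩ := hg
  refine ⟨M + N, by positivity, fun x hx => ?_, fun x hx y hy => ?_⟩
  · exact (abs_sub _ _).trans (add_le_add (h1 x hx) (h3 x hx))
  · have e : f x - g x - (f y - g y) = (f x - f y) - (g x - g y) := by ring
    rw [e, add_mul]
    exact (abs_sub _ _).trans (add_le_add (h2 x hx y hy) (h4 x hx y hy))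

lemma LB.inv {f : ℝ → ℝ} {S : Set ℝ} (hf : LB f S) (m : ℝ) (hm : 0 < m) (hfm : ∀ x ∈ S, m ≤ f x) :
    LB (fun x => (f x)⁻¹) S := by
  obtain ⟨M, hM, h1, h2⟩ := hf
  have h5 : ∀ x ∈ S, |(f x)⁻¹| ≤ m⁻¹ := fun x hx => by
    have := hfm x hx
    have h0 : 0 < f x := hm.trans_le this
    rw [abs_of_pos (by positivity)]
    exact inv_anti₀ hm this
  refine ⟨m⁻¹ + m⁻¹ * M * m⁻¹, by positivity, fun x hx => ?_, fun x hx y hy => ?_⟩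
  · have : 0 ≤ m⁻¹ * M * m⁻¹ := by positivity
    linarith [h5 x hx]
  · have hx0 : f x ≠ 0 := by linarith [hfm x hx]
    have hy0 : f y ≠ 0 := by linarith [hfm y hy]
    have e : (f x)⁻¹ - (f y)⁻¹ = (f x)⁻¹ * (f y - f x) * (f y)⁻¹ := by field_simp
    rw [e, abs_mul, abs_mul, abs_sub_comm (f y)]
    have a1 := mul_le_mul (h5 x hx) (h2 x hx y hy) (abs_nonneg _) (by positivity)
    have a2 := mul_le_mul a1 (h5 y hy) (abs_nonneg _) (by positivity)
    have : 0 ≤ m⁻¹ * |x - y| := by positivity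
    linarith

lemma exists_pos_lb (f : ℝ → ℝ) (a b : ℝ) (hab : a ≤ b) (hf : ContinuousOn f (Icc a b))
    (hpos : ∀ x ∈ Icc a b, 0 < f x) : ∃ m > 0, ∀ x ∈ Icc a b, m ≤ f x := by
  obtain ⟨x, hx, hx2⟩ := isCompact_Icc.exists_isMinOn (nonempty_Icc.2 hab) hf
  exact ⟨f x, hpos x hx, fun y hy => hx2 hy⟩

/-- Lipschitz transplantation of `k` through the increasing function `ρ`. -/
lemma aux_transplant (ρ k : ℝ → ℝ) (a m : ℝ) (ha : a < 1) (hm : 0 < m)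
    (hρ : ContinuousOn ρ (Icc a 1))
    (hs : ∀ x ∈ Icc a 1, ∀ y ∈ Icc a 1, x ≤ y → m * (y - x) ≤ ρ y - ρ x) (hk : LB k (Icc a 1)) :
    ∃ (h : ℝ → ℝ) (K : NNReal), LipschitzWith K h ∧ (∀ s ∈ Icc a 1, h (ρ s) = k s) ∧
      ∀ u, ρ 1 ≤ u → h u = k 1 := by
  obtain ⟨M, hM, -, hk⟩ := hk
  have ha1 : a ∈ Icc a 1 := ⟨le_rfl, ha.le⟩
  have h11 : (1:ℝ) ∈ Icc a 1 := ⟨ha.le, le_rfl⟩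
  have hle : ρ a ≤ ρ 1 := by nlinarith [hs a ha1 1 h11 ha.le]
  have hsurj : ∀ u ∈ Icc (ρ a) (ρ 1), ∃ s ∈ Icc a 1, ρ s = u := fun u hu =>
    intermediate_value_Icc ha.le hρ hu
  choose! σ hσ1 hσ2 using hsurj
  have habs : ∀ x ∈ Icc a 1, ∀ y ∈ Icc a 1, m * |x - y| ≤ |ρ x - ρ y| := by
    intro x hx y hy
    rcases le_total x y with h | h
    · rw [abs_sub_comm, abs_of_nonneg (sub_nonneg.2 h), abs_sub_comm (ρ x)]
      exact (hs x hx y hy h).trans (le_abs_self _)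
    · rw [abs_of_nonneg (sub_nonneg.2 h)]
      exact (hs y hy x hx h).trans (le_abs_self _)
  have hinv : ∀ s ∈ Icc a 1, σ (ρ s) = s := by
    intro s hs'
    have hin : ρ s ∈ Icc (ρ a) (ρ 1) :=
      ⟨by nlinarith [hs a ha1 s hs' hs'.1, hs'.1], by nlinarith [hs s hs' 1 h11 hs'.2, hs'.2]⟩
    have h1 := habs _ (hσ1 _ hin) s hs'
    rw [hσ2 _ hin, sub_self, abs_zero] at h1
    have h2 : |σ (ρ s) - s| ≤ 0 := by
      by_contra hcon
      push Not at hcon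
      nlinarith
    exact sub_eq_zero.1 (abs_nonpos_iff.1 h2)
  refine ⟨fun u => k (σ (projIcc (ρ a) (ρ 1) hle u)), ⟨M / m, by positivity⟩, ?_, ?_, ?_⟩
  · refine LipschitzWith.of_dist_le_mul fun u v => ?_
    have hp := (LipschitzWith.projIcc hle).dist_le_mul u v
    set u' := projIcc (ρ a) (ρ 1) hle u
    set v' := projIcc (ρ a) (ρ 1) hle v
    have h1 := hk _ (hσ1 _ u'.2) _ (hσ1 _ v'.2)
    have h2 := habs _ (hσ1 _ u'.2) _ (hσ1 _ v'.2)
    rw [hσ2 _ u'.2, hσ2 _ v'.2] at h2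
    rw [Subtype.dist_eq, Real.dist_eq, NNReal.coe_one, one_mul] at hp
    rw [Real.dist_eq]
    refine h1.trans ?_
    show _ ≤ M / m * _
    rw [div_mul_eq_mul_div, mul_div_assoc]
    refine mul_le_mul_of_nonneg_left ?_ hM
    rw [le_div_iff₀ hm]
    linarith
  · intro s hs'
    have hin : ρ s ∈ Icc (ρ a) (ρ 1) :=
      ⟨by nlinarith [hs a ha1 s hs' hs'.1, hs'.1], by nlinarith [hs s hs' 1 h11 hs'.2, hs'.2]⟩
    simp only
    rw [projIcc_of_mem hle hin]
    simp only
    rw [hinv s hs']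
  · intro u hu
    simp only
    rw [projIcc_of_right_le hle hu]
    simp only
    rw [hinv 1 h11]

lemma alpha_diff (R : ℝ) (hR0 : 0 ≤ R) (hR1 : R < 1) (c : ℝ → ℝ)
    (hpos : ∀ r ∈ Set.Icc R 1, 0 < c r)
    (hC11 : IsC11On c R) (hHerg : HerglotzCond c R) (r₀ : ℝ) (hr₀ : r₀ ∈ Ioo R 1) :
    DifferentiableAt ℝ (alphaFun c) r₀ := by
  obtain ⟨c', K, hc, hcL⟩ := hC11
  obtain ⟨a, haR, har⟩ := exists_between hr₀.1
  have ha0 : 0 < a := by linarith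
  have ha1 : a < 1 := har.trans hr₀.2
  have hsub : Icc a 1 ⊆ Icc R 1 := Icc_subset_Icc_left haR.le
  set ρ : ℝ → ℝ := fun s => s / c s with hρdef
  set ρ' : ℝ → ℝ := fun s => (c s - s * c' s) / c s ^ 2 with hρ'def
  have hρd : ∀ s ∈ Icc R 1, HasDerivWithinAt ρ (ρ' s) (Icc R 1) s := by
    intro s hs
    have := (hasDerivWithinAt_id s (Icc R 1)).div (hc s hs) (hpos s hs).ne'
    have e : ρ' s = (1 * c s - id s * c' s) / c s ^ 2 := by simp [hρ'def]
    rw [e]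
    exact this
  have hρ'pos : ∀ s ∈ Icc R 1, 0 < ρ' s := by
    intro s hs
    have := hHerg s hs
    rwa [(hρd s hs).derivWithin (uniqueDiffOn_Icc hR1 s hs)] at this
  have hdpos : ∀ s ∈ Icc R 1, 0 < c s - s * c' s := by
    intro s hs
    have h1 := hρ'pos s hs
    have h2 := hpos s hs
    exact (div_pos_iff_of_pos_right (by positivity)).1 h1
  have hcc : ContinuousOn c (Icc a 1) := fun s hs =>
    ((hc s (hsub hs)).continuousWithinAt).mono hsub
  have hc'c : ContinuousOn c' (Icc a 1) := hcL.continuousOn.mono hsub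
  have hρc : ContinuousOn ρ (Icc a 1) := fun s hs =>
    ((hρd s (hsub hs)).continuousWithinAt).mono hsub
  have hdc : ContinuousOn (fun s => c s - s * c' s) (Icc a 1) := by fun_prop
  have hρ'c : ContinuousOn ρ' (Icc a 1) :=
    hdc.div (hcc.pow 2) (fun s hs => by have := hpos s (hsub hs); positivity)
  obtain ⟨m, hm, hm2⟩ := exists_pos_lb ρ' a 1 ha1.le hρ'c (fun s hs => hρ'pos s (hsub hs))
  have hρda : ∀ s ∈ Ioo a 1, HasDerivAt ρ (ρ' s) s := fun s hs =>
    (hρd s (hsub (Ioo_subset_Icc_self hs))).hasDerivAt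
      (Icc_mem_nhds (haR.trans hs.1) hs.2)
  have hslope : ∀ x ∈ Icc a 1, ∀ y ∈ Icc a 1, x ≤ y → m * (y - x) ≤ ρ y - ρ x := by
    refine (convex_Icc a 1).mul_sub_le_image_sub_of_le_deriv hρc ?_ ?_
    · rw [interior_Icc]
      exact fun s hs => (hρda s hs).differentiableAt.differentiableWithinAt
    · rw [interior_Icc]
      intro s hs
      rw [(hρda s hs).deriv]
      exact hm2 s (Ioo_subset_Icc_self hs)
  have hρmono : StrictMonoOn ρ (Icc a 1) := by
    intro x hx y hy hxy
    have := hslope x hx y hy hxy.le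
    nlinarith
  have hρpos : ∀ s ∈ Icc a 1, 0 < ρ s := fun s hs =>
    div_pos (ha0.trans_le hs.1) (hpos s (hsub hs))
  -- Lipschitz bounds
  have LBid : LB (fun s => s) (Icc a 1) := by
    refine ⟨1, zero_le_one, fun x hx => ?_, fun x _ y _ => by simp⟩
    rw [abs_of_pos (ha0.trans_le hx.1)]; exact hx.2
  have LBc' : LB c' (Icc a 1) := by
    obtain ⟨C, hC⟩ := isCompact_Icc.exists_bound_of_continuousOn hc'c
    refine ⟨max C K, le_max_of_le_right K.2, fun x hx => (hC x hx).trans (le_max_left _ _), ?_⟩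
    intro x hx y hy
    have := hcL.dist_le_mul x (hsub hx) y (hsub hy)
    rw [Real.dist_eq, Real.dist_eq] at this
    exact this.trans (mul_le_mul_of_nonneg_right (le_max_right _ _) (abs_nonneg _))
  have LBc : LB c (Icc a 1) := by
    obtain ⟨C, hC⟩ := isCompact_Icc.exists_bound_of_continuousOn hcc
    obtain ⟨D, hD⟩ := isCompact_Icc.exists_bound_of_continuousOn hc'c
    have hC0 : 0 ≤ C := (norm_nonneg _).trans (hC 1 ⟨ha1.le, le_rfl⟩)
    refine ⟨max C D, le_max_of_le_left hC0, fun x hx => (hC x hx).trans (le_max_left _ _), ?_⟩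
    intro x hx y hy
    have := (convex_Icc a 1).norm_image_sub_le_of_norm_hasDerivWithin_le
      (fun s hs => (hc s (hsub hs)).mono hsub) hD hy hx
    exact this.trans (mul_le_mul_of_nonneg_right (le_max_right _ _) (abs_nonneg _))
  obtain ⟨d, hd, hd2⟩ := exists_pos_lb (fun s => (s * s) * (c s - s * c' s)) a 1 ha1.le
    (by fun_prop) (fun s hs => by
      have := hdpos s (hsub hs)
      have : 0 < s := ha0.trans_le hs.1
      positivity)
  have LBk : LB (fun s => (c s * (c s * c s)) * ((s * s) * (c s - s * c' s))⁻¹) (Icc a 1) :=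
    (LBc.mul (LBc.mul LBc)).mul
      (((LBid.mul LBid).mul (LBc.sub (LBid.mul LBc'))).inv d hd hd2)
  obtain ⟨h, K', hL, hh, hh1⟩ := aux_transplant ρ _ a m ha1 hm hρc hslope LBk
  set P := ρ 1 with hP
  set k1 := h P with hk1
  have hPpos : 0 < P := hρpos 1 ⟨ha1.le, le_rfl⟩
  have hhP : ∀ u, P ≤ u → h u = k1 := fun u hu => by
    rw [hh1 u hu, hk1, hh1 P le_rfl]
  set Φ : ℝ → ℝ := fun p => p * ((∫ t in (0:ℝ)..P, h (√(p ^ 2 + t ^ 2))) -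
    k1 * (P - √(P ^ 2 - p ^ 2))) with hΦ
  have hcontH : ∀ p : ℝ, Continuous fun t => h (√(p ^ 2 + t ^ 2)) := fun p =>
    hL.continuous.comp (by fun_prop)
  have hΦeq : ∀ p, 0 < p → p < P → Φ p = ∫ t in (0:ℝ)..√(P ^ 2 - p ^ 2), p * h (√(p ^ 2 + t ^ 2)) := by
    intro p hp hpP
    have hT : √(P ^ 2 - p ^ 2) ≤ P := by
      rw [Real.sqrt_le_left hPpos.le]
      nlinarith
    have e1 := intervalIntegral.integral_add_adjacent_intervals
      ((hcontH p).intervalIntegrable (μ := volume) 0 (√(P ^ 2 - p ^ 2)))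
      ((hcontH p).intervalIntegrable (μ := volume) (√(P ^ 2 - p ^ 2)) P)
    have e2 : ∫ t in (√(P ^ 2 - p ^ 2))..P, h (√(p ^ 2 + t ^ 2)) = k1 * (P - √(P ^ 2 - p ^ 2)) := by
      rw [intervalIntegral.integral_congr (g := fun _ => k1)]
      · rw [intervalIntegral.integral_const, smul_eq_mul, mul_comm]
      · intro t ht
        rw [uIcc_of_le hT] at ht
        apply hhP
        apply Real.le_sqrt_of_sq_le
        have := Real.sq_sqrt (show 0 ≤ P ^ 2 - p ^ 2 by nlinarith)
        have := pow_le_pow_left₀ (Real.sqrt_nonneg _) ht.1 2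
        linarith
    rw [intervalIntegral.integral_const_mul, hΦ]
    simp only
    rw [← e1, e2]
    ring
  have halpha : ∀ r ∈ Ioo a 1, alphaFun c r = Φ (ρ r) := by
    intro r hr
    have hrI := Ioo_subset_Icc_self hr
    have hsub2 : Icc r 1 ⊆ Icc a 1 := Icc_subset_Icc_left hr.1.le
    have hpP : ρ r < P := hρmono hrI ⟨ha1.le, le_rfl⟩ hr.2
    rw [hΦeq _ (hρpos r hrI) hpP]
    rw [aux_cov ρ ρ' _ r hr.2 (hρpos r hrI) (hρc.mono hsub2)
      (fun s hs => hρda s ⟨hr.1.trans hs.1, hs.2⟩)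
      (fun s hs => hρ'pos s (hsub (hsub2 (Ioo_subset_Icc_self hs)))) (hρmono.mono hsub2)]
    unfold alphaFun
    rw [intervalIntegral.integral_of_le hr.2.le, intervalIntegral.integral_of_le hr.2.le,
      integral_Ioc_eq_integral_Ioo, integral_Ioc_eq_integral_Ioo]
    refine setIntegral_congr_fun measurableSet_Ioo fun s hs => ?_
    have hsI : s ∈ Icc a 1 := hsub2 (Ioo_subset_Icc_self hs)
    have hs0 : 0 < s := ha0.trans_le hsI.1
    have hr0 : 0 < r := ha0.trans_le hrI.1
    have hcs := hpos s (hsub hsI)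
    have hcr := hpos r (hsub hrI)
    have hds := hdpos s (hsub hsI)
    have hps := hρpos s hsI
    have hpr := hρpos r hrI
    have hlt : ρ r < ρ s := hρmono hrI hsI hs.1
    have hq : 0 < ρ s ^ 2 - ρ r ^ 2 := by nlinarith
    have hqs := Real.sqrt_pos.2 hq
    have e1 : √(ρ r ^ 2 + √(ρ s ^ 2 - ρ r ^ 2) ^ 2) = ρ s := by
      rw [Real.sq_sqrt hq.le, add_sub_cancel, Real.sqrt_sq hps.le]
    have e2 : r * c s / (s * c r) = ρ r / ρ s := by
      simp only [hρdef]; field_simp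
    have e3 : √(1 - (ρ r / ρ s) ^ 2) = √(ρ s ^ 2 - ρ r ^ 2) / ρ s := by
      rw [show 1 - (ρ r / ρ s) ^ 2 = (ρ s ^ 2 - ρ r ^ 2) / ρ s ^ 2 by field_simp,
        Real.sqrt_div hq.le, Real.sqrt_sq hps.le]
    rw [e1, e2, e3, hh s hsI]
    generalize √(ρ s ^ 2 - ρ r ^ 2) = w at hqs
    simp only [hρdef, hρ'def]
    field_simp
  have hr₀I : r₀ ∈ Ioo a 1 := ⟨har, hr₀.2⟩
  have hev : alphaFun c =ᶠ[𝓝 r₀] fun r => Φ (ρ r) := by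
    filter_upwards [isOpen_Ioo.mem_nhds hr₀I] with r hr using halpha r hr
  have hp0 := hρpos r₀ (Ioo_subset_Icc_self hr₀I)
  have hp1 : ρ r₀ < P := hρmono (Ioo_subset_Icc_self hr₀I) ⟨ha1.le, le_rfl⟩ hr₀.2
  have hΦd : DifferentiableAt ℝ Φ (ρ r₀) := by
    refine differentiableAt_id.mul ((aux_param h K' hL P (ρ r₀) hPpos.le hp0).sub ?_)
    refine DifferentiableAt.const_mul (DifferentiableAt.const_sub (DifferentiableAt.sqrt (by fun_prop) ?_) _) _
    nlinarith
  exact (hΦd.comp r₀ (hρda r₀ hr₀I).differentiableAt).congr_of_eventuallyEq hev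

end Aux7

theorem stmt7 (R : ℝ) (hR0 : 0 ≤ R) (hR1 : R < 1) (c : ℝ → ℝ)
    (hpos : ∀ r ∈ Set.Icc R 1, 0 < c r)
    (hC11 : IsC11On c R) (hHerg : HerglotzCond c R)
    (hccc : {r | r ∈ Set.Ioo R 1 ∧ deriv (alphaFun c) r = 0}.Countable) :
    {r | r ∈ Set.Ioo R 1 ∧ (∃ q : ℚ, alphaFun c r = (q : ℝ) * Real.pi) ∧
        deriv (alphaFun c) r ≠ 0}.Countable ∧
    Set.Ioo R 1 ⊆ closure {r | r ∈ Set.Ioo R 1 ∧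
        (∃ q : ℚ, alphaFun c r = (q : ℝ) * Real.pi) ∧ deriv (alphaFun c) r ≠ 0} := by
  refine ⟨?_, Aux7.aux_dense (alphaFun c) R
    (fun x hx => Aux7.alpha_diff R hR0 hR1 c hpos hC11 hHerg x hx) hccc⟩
  refine (Set.countable_iUnion fun q : ℚ =>
    Aux7.aux_countable (alphaFun c) ((q : ℝ) * Real.pi)).mono ?_
  rintro r ⟨-, ⟨q, hq⟩, hr⟩
  exact Set.mem_iUnion.2 ⟨q, hq, hr⟩
end

section
/- Let 0 ≤ R < 1, ε > 0, and let c_τ : [R,1] → (0,∞), τ ∈ (−ε,ε), be a family of C^{1,1} functions, each satisfying the Herglotz condition, such that (τ,r) ↦ c_τ(r) is C¹ on (−ε,ε) × [R,1] and the map (τ,r) ↦ α_τ(r) is C¹ on (−ε,ε) × (R,1). Then for every r ∈ (R,1) with α_0(r) ∈ π·ℚ and α_0'(r) ≠ 0, there exist δ ∈ (0,ε) and a C¹ function φ : (−δ,δ) → (R,1) such that φ(0) = r, α_τ(φ(τ)) = α_0(r) for all τ ∈ (−δ,δ), and the function τ ↦ L_τ(φ(τ)) is differentiable on (−δ,δ).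 -/
open Set Filter Topology MeasureTheory

lemma sqrt_sub_mul_le (a b : ℝ) : |√a - √b| * √|b| ≤ |a - b| := by
  rcases le_total b 0 with hb | hb
  · rw [Real.sqrt_eq_zero_of_nonpos hb, sub_zero, abs_of_nonneg (Real.sqrt_nonneg _), abs_of_nonpos hb]
    rcases le_total a 0 with ha | ha
    · rw [Real.sqrt_eq_zero_of_nonpos ha, zero_mul]; positivity
    · have h1 := Real.sq_sqrt ha
      have h2 := Real.sq_sqrt (neg_nonneg.2 hb)
      refine le_trans ?_ (le_abs_self _)
      nlinarith [sq_nonneg (√a - √(-b))]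
  · rw [abs_of_nonneg hb]
    have h2 := Real.sq_sqrt hb
    have h3 := Real.sqrt_nonneg b
    rcases le_total a 0 with ha | ha
    · rw [Real.sqrt_eq_zero_of_nonpos ha, zero_sub, abs_neg, abs_of_nonneg (Real.sqrt_nonneg _), abs_of_nonpos (by linarith)]
      nlinarith
    · have h1 := Real.sq_sqrt ha
      have h4 := Real.sqrt_nonneg a
      have : a - b = (√a - √b) * (√a + √b) := by nlinarith
      rw [this, abs_mul, abs_of_nonneg (by positivity : 0 ≤ √a + √b)]
      gcongr; linarith

lemma integrable_sing (a b x0 : ℝ) :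
    IntervalIntegrable (fun s => (√|s - x0|)⁻¹) volume a b := by
  have h1 : ∀ c d : ℝ, IntervalIntegrable (fun s : ℝ => (√s)⁻¹) volume c d := by
    intro c d
    have := intervalIntegral.intervalIntegrable_rpow' (a := c) (b := d) (r := -(1/2)) (by norm_num)
    refine (this.norm).mono_fun ?_ ?_
    · exact (Real.continuous_sqrt.measurable.inv).aestronglyMeasurable
    · filter_upwards with s
      rcases le_total s 0 with hs | hs
      · simp [Real.sqrt_eq_zero_of_nonpos hs]
      · rw [Real.rpow_neg hs, ← Real.sqrt_eq_rpow]; simp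
  have h2 : IntervalIntegrable (fun s : ℝ => (√(s - x0))⁻¹) volume a b := by
    simpa using (h1 (a - x0) (b - x0)).comp_sub_right x0
  have h3 : IntervalIntegrable (fun s : ℝ => (√(x0 - s))⁻¹) volume a b := by
    simpa using (h1 (x0 - a) (x0 - b)).comp_sub_left x0
  refine (h2.add h3).congr ?_
  intro s _
  simp only
  rcases le_total (s - x0) 0 with hs | hs
  · rw [abs_of_nonpos hs, Real.sqrt_eq_zero_of_nonpos hs]; simp
  · rw [abs_of_nonneg hs, Real.sqrt_eq_zero_of_nonpos (x := x0 - s) (by linarith)]; simp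

lemma diff_integral {μ : Measure ℝ} {F : ℝ → ℝ → ℝ} {x₀ : ℝ} {S : Set ℝ} {bound : ℝ → ℝ}
    (hs : S ∈ 𝓝 x₀)
    (hF_meas : ∀ x ∈ S, AEStronglyMeasurable (F x) μ) (hF_int : Integrable (F x₀) μ)
    (h_lipsch : ∀ᵐ a ∂μ, ∀ x ∈ S, ‖F x a - F x₀ a‖ ≤ bound a * ‖x - x₀‖)
    (bound_integrable : Integrable (bound : ℝ → ℝ) μ)
    (h_diff : ∀ᵐ a ∂μ, DifferentiableAt ℝ (F · a) x₀) :
    DifferentiableAt ℝ (fun x => ∫ a, F x a ∂μ) x₀ := by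
  have hd : AEStronglyMeasurable (fun a => deriv (F · a) x₀) μ := by
    have h0 : ∃ u : ℕ → ℝ, (∀ n, u n ∈ S ∧ u n ≠ x₀) ∧ Tendsto u atTop (𝓝[≠] x₀) := by
      have hne : (𝓝[≠] x₀).NeBot := inferInstance
      obtain ⟨u, hu⟩ := exists_seq_tendsto (𝓝[≠] x₀)
      have hS : ∀ᶠ y in 𝓝[≠] x₀, y ∈ S ∧ y ≠ x₀ :=
        Filter.inter_mem (nhdsWithin_le_nhds hs) self_mem_nhdsWithin
      obtain ⟨N, hN⟩ := eventually_atTop.1 (hu.eventually hS)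
      exact ⟨fun n => u (n + N), fun n => hN _ (by omega), hu.comp (tendsto_add_atTop_nat N)⟩
    obtain ⟨u, hu, hu'⟩ := h0
    refine aestronglyMeasurable_of_tendsto_ae atTop
      (f := fun n a => (u n - x₀)⁻¹ * (F (u n) a - F x₀ a)) ?_ ?_
    · intro n
      exact ((hF_meas _ (hu n).1).sub hF_int.1).const_mul _
    · filter_upwards [h_diff] with a ha
      have := (hasDerivAt_iff_tendsto_slope.1 ha.hasDerivAt).comp hu'
      refine this.congr fun n => ?_
      simp [slope]
  have hd' : AEStronglyMeasurable
      (fun a => ContinuousLinearMap.toSpanSingleton ℝ (deriv (F · a) x₀)) μ := 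
    (ContinuousLinearMap.toSpanSingletonCLE (𝕜 := ℝ) (E := ℝ)).continuous.comp_aestronglyMeasurable hd
  exact (hasFDerivAt_integral_of_dominated_loc_of_lip' hs hF_meas hF_int hd' h_lipsch
    bound_integrable (h_diff.mono fun a ha => ha.hasDerivAt.hasFDerivAt)).2.differentiableAt

lemma bound_below {c : ℝ → ℝ} {R : ℝ} (hR1 : R < 1)
    (hpos : ∀ r ∈ Set.Icc R 1, 0 < c r) (hc : ContDiffOn ℝ 1 c (Icc R 1))
    (hH : ∀ r ∈ Set.Icc R 1, 0 < derivWithin (fun s => s / c s) (Set.Icc R 1) r) :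
    ∃ m > 0, ∀ x ∈ Icc R 1, ∀ y ∈ Icc R 1, x ≤ y → m * (y - x) ≤ y / c y - x / c x := by
  have hρ : ContDiffOn ℝ 1 (fun s => s / c s) (Icc R 1) :=
    contDiffOn_id.div hc fun x hx => (hpos x hx).ne'
  have hcont := hρ.continuousOn_derivWithin (uniqueDiffOn_Icc hR1) le_rfl
  obtain ⟨x0, hx0, hmin⟩ := isCompact_Icc.exists_isMinOn (nonempty_Icc.2 hR1.le) hcont
  refine ⟨_, hH x0 hx0, fun x hx y hy hxy => ?_⟩
  refine (convex_Icc R 1).mul_sub_le_image_sub_of_le_deriv (f := fun s => s / c s) hρ.continuousOn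
    ((hρ.differentiableOn one_ne_zero).mono interior_subset) ?_ x hx y hy hxy
  intro z hz
  rw [← derivWithin_of_mem_nhds (mem_interior_iff_mem_nhds.1 hz)]
  exact hmin (interior_subset hz)

lemma diff_T {G : ℝ × ℝ → ℝ} {V : Set ℝ} {a τ0 x0 m : ℝ} (hV : V ∈ 𝓝 τ0) (ha : 0 < a) (ha1 : a < 1)
    (hG : ContDiffOn ℝ 1 G (V ×ˢ Icc a 1)) (hm : 0 < m)
    (hlow : ∀ s ∈ Icc a 1, m * |s - x0| ≤ |G (τ0, s)|) :
    DifferentiableAt ℝ (fun τ => ∫ s in a..1, √(G (τ, s)) / s) τ0 := by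
  obtain ⟨η, hη, hηV⟩ := Metric.nhds_basis_closedBall.mem_iff.1 hV
  rw [Real.closedBall_eq_Icc] at hηV
  have hsub : Icc (τ0 - η) (τ0 + η) ×ˢ Icc a 1 ⊆ V ×ˢ Icc a 1 := prod_mono hηV Subset.rfl
  obtain ⟨K, hK⟩ := (hG.mono hsub).exists_lipschitzOnWith one_ne_zero
    ((convex_Icc _ _).prod (convex_Icc _ _)) (isCompact_Icc.prod isCompact_Icc)
  have h0 : τ0 ∈ Icc (τ0 - η) (τ0 + η) := by constructor <;> linarith
  have hcont : ∀ x ∈ Icc (τ0 - η) (τ0 + η), ContinuousOn (fun s => √(G (x, s)) / s) (Icc a 1) := by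
    intro x hx
    refine ContinuousOn.div (ContinuousOn.sqrt ?_) continuousOn_id fun s hs => (ha.trans_le hs.1).ne'
    exact hG.continuousOn.comp (by fun_prop) fun s hs => ⟨hηV hx, hs⟩
  simp_rw [intervalIntegral.integral_of_le ha1.le]
  have hne : ∀ᵐ s ∂(volume.restrict (Ioc a 1)), s ∈ Ioc a 1 ∧ s ≠ x0 := by
    refine (ae_restrict_mem measurableSet_Ioc).and ?_
    exact ae_restrict_of_ae (Measure.ae_ne volume x0)
  refine diff_integral (S := Icc (τ0 - η) (τ0 + η))
    (bound := fun s => (K * a⁻¹ * (√m)⁻¹) * (√|s - x0|)⁻¹) (Icc_mem_nhds (by linarith) (by linarith))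
    ?_ ?_ ?_ ?_ ?_
  · intro x hx
    exact ((hcont x hx).mono Ioc_subset_Icc_self).aestronglyMeasurable measurableSet_Ioc
  · exact ((hcont τ0 h0).integrableOn_Icc).mono_set Ioc_subset_Icc_self
  · filter_upwards [hne] with s ⟨hs, hsx⟩ x hx
    have hs' := Ioc_subset_Icc_self hs
    have hs0 : 0 < s := ha.trans hs.1
    have h1 := sqrt_sub_mul_le (G (x, s)) (G (τ0, s))
    have h2 := hlow s hs'
    have h3 : |G (x, s) - G (τ0, s)| ≤ K * |x - τ0| := by
      have := hK.dist_le_mul (x, s) ⟨hx, hs'⟩ (τ0, s) ⟨h0, hs'⟩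
      simpa [Real.dist_eq, Prod.dist_eq] using this
    have h4 : 0 < |s - x0| := abs_pos.2 (sub_ne_zero.2 hsx)
    have h5 : √m * √|s - x0| ≤ √|G (τ0, s)| := by
      rw [← Real.sqrt_mul hm.le]; exact Real.sqrt_le_sqrt h2
    have h6 : 0 < √m * √|s - x0| := by positivity
    have h7 : |√(G (x, s)) - √(G (τ0, s))| * (√m * √|s - x0|) ≤ K * |x - τ0| :=
      (mul_le_mul_of_nonneg_left h5 (abs_nonneg _)).trans (h1.trans h3)
    have h8 : |√(G (x, s)) - √(G (τ0, s))| ≤ K * |x - τ0| / (√m * √|s - x0|) :=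
      (le_div_iff₀ h6).2 h7
    rw [← sub_div, Real.norm_eq_abs, Real.norm_eq_abs, abs_div, abs_of_pos hs0]
    calc _ ≤ |√(G (x, s)) - √(G (τ0, s))| / a := by gcongr; exact hs.1.le
      _ ≤ (K * |x - τ0| / (√m * √|s - x0|)) / a := by gcongr
      _ = _ := by field_simp
  · have := (integrable_sing a 1 x0).const_mul (K * a⁻¹ * (√m)⁻¹)
    exact (intervalIntegrable_iff_integrableOn_Ioc_of_le ha1.le).1 this
  · filter_upwards [hne] with s ⟨hs, hsx⟩
    have hs' := Ioc_subset_Icc_self hs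
    have h2 := hlow s hs'
    have h4 : 0 < |s - x0| := abs_pos.2 (sub_ne_zero.2 hsx)
    have h5 : G (τ0, s) ≠ 0 := abs_pos.1 (lt_of_lt_of_le (by positivity) h2)
    have h6 : DifferentiableAt ℝ (fun x => G (x, s)) τ0 := by
      have : ContDiffOn ℝ 1 (fun x => G (x, s)) V :=
        hG.comp (by fun_prop) fun x hx => ⟨hx, hs'⟩
      exact (this.contDiffAt hV).differentiableAt one_ne_zero
    exact (h6.sqrt h5).div_const s

lemma split_L {c : ℝ → ℝ} {R r a m : ℝ} (hR0 : 0 ≤ R) (ha : R < a) (har : a ≤ r) (hr1 : r < 1)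
    (hpos : ∀ r ∈ Set.Icc R 1, 0 < c r) (hc : ContDiffOn ℝ 1 c (Icc R 1))
    (hm : 0 < m)
    (hlow : ∀ x ∈ Icc R 1, ∀ y ∈ Icc R 1, x ≤ y → m * (y - x) ≤ y / c y - x / c x) :
    Lfun c r = (r / c r) * alphaFun c r + ∫ s in a..1, √((s / c s) ^ 2 - (r / c r) ^ 2) / s := by
  set p := r / c r with hp
  have hrm : r ∈ Icc R 1 := ⟨by linarith, hr1.le⟩
  have hr0 : 0 < r := by linarith
  have hcr := hpos r hrm
  have hp0 : 0 < p := div_pos hr0 hcr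
  have hcc := hc.continuousOn
  have hT : ∀ x y, x ∈ Icc a 1 → y ∈ Icc a 1 →
      IntervalIntegrable (fun s => √((s / c s) ^ 2 - p ^ 2) / s) volume x y := by
    intro x y hx hy
    refine ContinuousOn.intervalIntegrable ?_
    have hsub : uIcc x y ⊆ Icc a 1 := uIcc_subset_Icc hx hy
    have hsub' : uIcc x y ⊆ Icc R 1 := hsub.trans (Icc_subset_Icc_left ha.le)
    refine ContinuousOn.div (ContinuousOn.sqrt ?_) continuousOn_id fun s hs => ?_
    · exact ((continuousOn_id.div (hcc.mono hsub') fun s hs => (hpos s (hsub' hs)).ne').pow 2).sub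
        continuousOn_const
    · have := (hsub hs).1
      have : 0 < s := by linarith
      exact this.ne'
  have hz : ∫ s in a..r, √((s / c s) ^ 2 - p ^ 2) / s = 0 := by
    rw [intervalIntegral.integral_congr (g := fun _ => (0 : ℝ))]
    · simp
    · intro s hs
      rw [uIcc_of_le har] at hs
      have hsm : s ∈ Icc R 1 := ⟨by linarith [hs.1], by linarith [hs.2]⟩
      have h1 := hlow s hsm r hrm hs.2
      have h2 : 0 ≤ s / c s := div_nonneg (by linarith [hs.1]) (hpos s hsm).le
      have h3 : 0 ≤ m * (r - s) := mul_nonneg hm.le (by linarith [hs.2])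
      have : (s / c s) ^ 2 - p ^ 2 ≤ 0 := by nlinarith
      simp [Real.sqrt_eq_zero_of_nonpos this]
  rw [← intervalIntegral.integral_add_adjacent_intervals
    (hT a r ⟨le_rfl, by linarith⟩ ⟨har, hr1.le⟩) (hT r 1 ⟨har, hr1.le⟩ ⟨by linarith, le_rfl⟩), hz, zero_add]
  -- pointwise facts
  have hpt : ∀ s ∈ Ioc r 1, 0 < s ∧ 0 < c s ∧ p * m * (s - r) ≤ (s / c s) ^ 2 - p ^ 2 ∧
      √(1 - (r * c s / (s * c r)) ^ 2) = √((s / c s) ^ 2 - p ^ 2) / (s / c s) := by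
    intro s hs
    have hsm : s ∈ Icc R 1 := ⟨by linarith [hs.1], hs.2⟩
    have hs0 : 0 < s := by linarith [hs.1]
    have hcs := hpos s hsm
    have h1 := hlow r hrm s hsm hs.1.le
    have h3 : 0 < m * (s - r) := mul_pos hm (by linarith [hs.1])
    have hq : 0 < s / c s := div_pos hs0 hcs
    refine ⟨hs0, hcs, ?_, ?_⟩
    · nlinarith
    · rw [← Real.sqrt_sq hq.le, ← Real.sqrt_div' _ (sq_nonneg _), Real.sqrt_sq hq.le]
      congr 1
      rw [hp]; field_simp
  have hα : IntervalIntegrable (fun s => (r * c s) / (c r * s ^ 2) *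
      (√(1 - (r * c s / (s * c r)) ^ 2))⁻¹) volume r 1 := by
    refine ((integrable_sing r 1 r).const_mul (p * r⁻¹ * (√(p * m))⁻¹)).mono_fun ?_ ?_
    · rw [uIoc_of_le hr1.le]
      refine ContinuousOn.aestronglyMeasurable ?_ measurableSet_Ioc
      have hcs : ContinuousOn c (Ioc r 1) := hcc.mono fun s hs => ⟨by linarith [hs.1], hs.2⟩
      refine ContinuousOn.mul ?_ (ContinuousOn.inv₀ (ContinuousOn.sqrt ?_) ?_)
      · refine ContinuousOn.div (by fun_prop) (by fun_prop) fun s hs => ?_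
        have := (hpt s hs).1
        positivity
      · refine continuousOn_const.sub (ContinuousOn.pow ?_ 2)
        refine ContinuousOn.div (by fun_prop) (by fun_prop) fun s hs => ?_
        have := (hpt s hs).1
        positivity
      · intro s hs
        obtain ⟨h1, h2, h3, h4⟩ := hpt s hs
        rw [h4]
        have : 0 < p * m * (s - r) := mul_pos (by positivity) (by linarith [hs.1])
        have : 0 < (s / c s) ^ 2 - p ^ 2 := by linarith
        positivity
    · rw [uIoc_of_le hr1.le]
      filter_upwards [ae_restrict_mem measurableSet_Ioc] with s hs
      obtain ⟨h1, h2, h3, h4⟩ := hpt s hs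
      have h5 : 0 < s - r := by linarith [hs.1]
      have h6 : 0 < p * m * (s - r) := by positivity
      rw [h4, Real.norm_of_nonneg (by positivity), Real.norm_of_nonneg (by positivity), abs_of_pos h5]
      have h7 : √(p * m) * √(s - r) ≤ √((s / c s) ^ 2 - p ^ 2) := by
        rw [← Real.sqrt_mul (by positivity)]; exact Real.sqrt_le_sqrt h3
      have h8 : 0 < √(p * m) * √(s - r) := by positivity
      have h9 := h8.trans_le h7
      calc r * c s / (c r * s ^ 2) * (√((s / c s) ^ 2 - p ^ 2) / (s / c s))⁻¹
          = p * s⁻¹ * (√((s / c s) ^ 2 - p ^ 2))⁻¹ := by rw [hp]; field_simp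
        _ ≤ p * r⁻¹ * (√(p * m) * √(s - r))⁻¹ := by gcongr; exact hs.1.le
        _ = _ := by rw [mul_inv]; ring
  unfold Lfun alphaFun
  rw [← intervalIntegral.integral_const_mul,
    ← intervalIntegral.integral_add (hα.const_mul p) (hT r 1 ⟨har, hr1.le⟩ ⟨by linarith, le_rfl⟩)]
  refine intervalIntegral.integral_congr_ae (Eventually.of_forall fun s hs => ?_)
  rw [uIoc_of_le hr1.le] at hs
  obtain ⟨h1, h2, h3, h4⟩ := hpt s hs
  have h5 : 0 < s - r := by linarith [hs.1]
  have h6 : 0 < p * m * (s - r) := by positivity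
  have h7 : 0 < (s / c s) ^ 2 - p ^ 2 := by linarith
  rw [h4]
  have h8 : √((s / c s) ^ 2 - p ^ 2) ^ 2 = (s / c s) ^ 2 - p ^ 2 := Real.sq_sqrt h7.le
  have h9 : 0 < √((s / c s) ^ 2 - p ^ 2) := Real.sqrt_pos.2 h7
  have h10 : r = p * c r := by rw [hp]; field_simp
  have h11 : r * c s / (c r * s ^ 2) = p * c s / s ^ 2 := by rw [hp]; field_simp
  rw [h11]
  generalize √((s / c s) ^ 2 - p ^ 2) = w at *
  have h12 : p ^ 2 = (s / c s) ^ 2 - w ^ 2 := by linarith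
  have : p * (p * c s / s ^ 2 * (w / (s / c s))⁻¹) = p ^ 2 / (s * w) := by field_simp
  rw [this, h12]
  field_simp
  ring

theorem stmt8 (R : ℝ) (hR0 : 0 ≤ R) (hR1 : R < 1) (ε : ℝ) (hε : 0 < ε)
    (c : ℝ → ℝ → ℝ)
    (hpos : ∀ τ ∈ Set.Ioo (-ε) ε, ∀ r ∈ Set.Icc R 1, 0 < c τ r)
    (hC11 : ∀ τ ∈ Set.Ioo (-ε) ε, IsC11On (c τ) R)
    (hHerg : ∀ τ ∈ Set.Ioo (-ε) ε, HerglotzCond (c τ) R)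
    (hcC1 : ContDiffOn ℝ 1 (fun p : ℝ × ℝ => c p.1 p.2) (Set.Ioo (-ε) ε ×ˢ Set.Icc R 1))
    (hαC1 : ContDiffOn ℝ 1 (fun p : ℝ × ℝ => alphaFun (c p.1) p.2)
      (Set.Ioo (-ε) ε ×ˢ Set.Ioo R 1)) :
    ∀ r ∈ Set.Ioo R 1, (∃ q : ℚ, alphaFun (c 0) r = (q : ℝ) * Real.pi) →
      deriv (alphaFun (c 0)) r ≠ 0 →
      ∃ δ : ℝ, 0 < δ ∧ δ < ε ∧ ∃ φ : ℝ → ℝ,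
        ContDiffOn ℝ 1 φ (Set.Ioo (-δ) δ) ∧
        φ 0 = r ∧
        (∀ τ ∈ Set.Ioo (-δ) δ, φ τ ∈ Set.Ioo R 1 ∧
          alphaFun (c τ) (φ τ) = alphaFun (c 0) r) ∧
        (∀ τ ∈ Set.Ioo (-δ) δ, DifferentiableAt ℝ (fun t => Lfun (c t) (φ t)) τ) := by
  intro r hr _ hd
  set A : ℝ × ℝ → ℝ := fun p => alphaFun (c p.1) p.2 with hA
  have hcdf : ContDiffAt ℝ 1 A (0, r) :=
    hαC1.contDiffAt (prod_mem_nhds (Ioo_mem_nhds (by linarith) hε) (Ioo_mem_nhds hr.1 hr.2))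
  have hder : HasDerivAt (alphaFun (c 0)) (fderiv ℝ A (0, r) (0, 1)) r := by
    have h1 := (hcdf.differentiableAt one_ne_zero).hasFDerivAt
    have h2 : HasDerivAt (fun x : ℝ => ((0 : ℝ), x)) (0, 1) r :=
      (hasDerivAt_const r (0 : ℝ)).prodMk (hasDerivAt_id r)
    exact h1.comp_hasDerivAt r h2
  rw [hder.deriv] at hd
  have hinv : (fderiv ℝ A (0, r) ∘L .inr ℝ ℝ ℝ).IsInvertible := by
    set d := fderiv ℝ A (0, r) (0, 1) with hd'
    refine ContinuousLinearMap.IsInvertible.of_inverse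
      (g := ContinuousLinearMap.toSpanSingleton ℝ d⁻¹) ?_ ?_ <;>
    · ext
      simp [← hd', hd]
      try rw [show ((0 : ℝ), d⁻¹) = d⁻¹ • ((0 : ℝ), (1 : ℝ)) by simp, map_smul, ← hd']
      try simp [hd]
  set φ := hcdf.implicitFunction one_ne_zero hinv with hφ
  have e0 : φ 0 = r := hcdf.implicitFunction_apply_self one_ne_zero hinv
  have e1 : ∀ᶠ x in 𝓝 (0 : ℝ), A (x, φ x) = A (0, r) :=
    hcdf.eventually_apply_implicitFunction one_ne_zero hinv
  have e2 : ContDiffAt ℝ 1 φ 0 := hcdf.contDiffAt_implicitFunction one_ne_zero hinv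
  have e3 : ∀ᶠ x in 𝓝 (0 : ℝ), ContDiffAt ℝ 1 φ x := e2.eventually (by simp)
  have e4 : ∀ᶠ x in 𝓝 (0 : ℝ), φ x ∈ Ioo R 1 :=
    e2.continuousAt.eventually_mem (by rw [e0]; exact Ioo_mem_nhds hr.1 hr.2)
  obtain ⟨δ', hδ', hball⟩ := Metric.eventually_nhds_iff_ball.1 (e1.and (e3.and e4))
  have hδall : ∀ x ∈ Ioo (-(min δ' (ε / 2))) (min δ' (ε / 2)), x ∈ Ioo (-ε) ε ∧
      A (x, φ x) = A (0, r) ∧ ContDiffAt ℝ 1 φ x ∧ φ x ∈ Ioo R 1 := by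
    intro x hx
    have h1 := min_le_left δ' (ε / 2)
    have h2 := min_le_right δ' (ε / 2)
    refine ⟨⟨by linarith [hx.1], by linarith [hx.2]⟩, hball x ?_⟩
    rw [Real.ball_eq_Ioo]
    constructor <;> linarith [hx.1, hx.2]
  have hδlt : min δ' (ε / 2) < ε := (min_le_right _ _).trans_lt (by linarith)
  have hδ0 : 0 < min δ' (ε / 2) := lt_min hδ' (by linarith)
  generalize min δ' (ε / 2) = δ at *
  refine ⟨δ, hδ0, hδlt, φ, fun x hx => (hδall x hx).2.2.1.contDiffWithinAt, e0,
    fun x hx => ⟨(hδall x hx).2.2.2, (hδall x hx).2.1⟩, ?_⟩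
  intro τ hτ
  have hV : Ioo (-δ) δ ∈ 𝓝 τ := Ioo_mem_nhds hτ.1 hτ.2
  have hVsub : Ioo (-δ) δ ⊆ Ioo (-ε) ε := fun x hx => (hδall x hx).1
  have hφC : ContDiffOn ℝ 1 φ (Ioo (-δ) δ) := fun x hx => (hδall x hx).2.2.1.contDiffWithinAt
  have hρC : ContDiffOn ℝ 1 (fun p : ℝ × ℝ => p.2 / c p.1 p.2) (Ioo (-ε) ε ×ˢ Icc R 1) :=
    contDiffOn_snd.div hcC1 fun p hp => (hpos p.1 hp.1 p.2 hp.2).ne'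
  have hpC : ContDiffOn ℝ 1 (fun t => φ t / c t (φ t)) (Ioo (-δ) δ) :=
    hρC.comp (contDiffOn_id.prodMk hφC)
      fun x hx => ⟨hVsub hx, Ioo_subset_Icc_self (hδall x hx).2.2.2⟩
  have hcs : ∀ t ∈ Ioo (-ε) ε, ContDiffOn ℝ 1 (c t) (Icc R 1) := fun t ht =>
    hcC1.comp (g := fun p : ℝ × ℝ => c p.1 p.2) (f := fun s => (t, s)) (by fun_prop)
      fun s hs => ⟨ht, hs⟩
  have hφτ := (hδall τ hτ).2.2.2
  set a := (R + φ τ) / 2 with ha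
  have haR : R < a := by linarith [hφτ.1]
  have haφ : a < φ τ := by linarith [hφτ.1]
  have hev : (fun t => Lfun (c t) (φ t)) =ᶠ[𝓝 τ] fun t => (φ t / c t (φ t)) * A (0, r) +
      ∫ s in a..1, √((s / c t s) ^ 2 - (φ t / c t (φ t)) ^ 2) / s := by
    have h1 : ∀ᶠ t in 𝓝 τ, a < φ t :=
      (hδall τ hτ).2.2.1.continuousAt.eventually_mem (Ioi_mem_nhds haφ)
    filter_upwards [hV, h1] with t ht hat
    obtain ⟨h2, h3, h4, h5⟩ := hδall t ht
    obtain ⟨m, hm, hlow⟩ := bound_below hR1 (hpos t h2) (hcs t h2) (hHerg t h2)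
    rw [split_L hR0 haR hat.le h5.2 (hpos t h2) (hcs t h2) hm hlow, ← h3]
  rw [hev.differentiableAt_iff]
  refine DifferentiableAt.add ?_ ?_
  · exact ((hpC.contDiffAt hV).differentiableAt one_ne_zero).mul_const _
  · obtain ⟨m, hm, hlow⟩ :=
      bound_below hR1 (hpos τ (hVsub hτ)) (hcs τ (hVsub hτ)) (hHerg τ (hVsub hτ))
    have hφm := Ioo_subset_Icc_self hφτ
    have hp0 : 0 < φ τ / c τ (φ τ) :=
      div_pos (by linarith [hφτ.1]) (hpos τ (hVsub hτ) _ hφm)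
    refine diff_T (G := fun p : ℝ × ℝ => (p.2 / c p.1 p.2) ^ 2 - (φ p.1 / c p.1 (φ p.1)) ^ 2)
      (V := Ioo (-δ) δ) (x0 := φ τ) (m := m * (φ τ / c τ (φ τ))) hV (by linarith)
      (by linarith [hφτ.2]) ?_ (mul_pos hm hp0) ?_
    · refine ((hρC.mono (prod_mono hVsub (Icc_subset_Icc_left haR.le))).pow 2).sub
        (ContDiffOn.pow ?_ 2)
      exact hpC.comp contDiffOn_fst fun p hp => hp.1
    · intro s hs
      have hsm : s ∈ Icc R 1 := ⟨by linarith [hs.1], hs.2⟩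
      have hq0 : 0 < s / c τ s := div_pos (by linarith [hs.1]) (hpos τ (hVsub hτ) _ hsm)
      simp only
      set p := φ τ / c τ (φ τ) with hp
      have key : m * |s - φ τ| ≤ |s / c τ s - p| := by
        rcases le_total s (φ τ) with h | h
        · have := hlow s hsm _ hφm h
          rw [abs_sub_comm, abs_of_nonneg (by linarith : 0 ≤ φ τ - s), abs_sub_comm]
          exact this.trans (le_abs_self _)
        · have := hlow _ hφm s hsm h
          rw [abs_of_nonneg (by linarith : 0 ≤ s - φ τ)]
          exact this.trans (le_abs_self _)
      rw [sq_sub_sq, abs_mul, abs_of_pos (by positivity : 0 < s / c τ s + p)]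
      nlinarith [abs_nonneg (s / c τ s - p), abs_nonneg (s - φ τ)]
end

section
/- Let 0 ≤ R < 1 and let c : [R,1] → (0,∞) be C^{1,1} and satisfy the Herglotz condition. For a continuous function f : [R,1] → ℝ define Af(r) = ∫_r^1 (f(s)/c(s)) · (1 − (r c(s)/(s c(r)))^2)^{-1/2} ds for r ∈ (R,1). Then: (i) Af is continuous on (R,1); and (ii) the map f ↦ Af is injective on continuous functions, i.e. if f : [R,1] → ℝ is continuous and Af(r) = 0 for every r ∈ (R,1), then f vanishes identically on [R,1]. -/
/-- The Abel-type transform of a radial function `f` over the maximal geodesic of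
radius `r`. -/
noncomputable def Afun (c : ℝ → ℝ) (f : ℝ → ℝ) (r : ℝ) : ℝ :=
  ∫ s in r..1, (f s / c s) * (Real.sqrt (1 - (r * c s / (s * c r)) ^ 2))⁻¹

open Set MeasureTheory Filter Topology

lemma aux_abel_plane (H : ℝ → ℝ) (hH : Continuous H) (x B : ℝ) (hB : 0 < B)
    (hF : ∀ σ : ℝ, σ ^ 2 ≤ B → ∫ τ in (0:ℝ)..√(B - σ ^ 2), H (x + σ ^ 2 + τ ^ 2) = 0) :
    ∫ y in x..(x + B), H y = 0 := by
  set G : ℝ → ℝ := fun t => if t ≤ B then H (x + t) else 0 with hG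
  set S : Set (ℝ × ℝ) := {p | p.1 ^ 2 + p.2 ^ 2 ≤ B} with hS
  have hSc : IsClosed S := isClosed_le (by fun_prop) (by fun_prop)
  have hcomp : IsCompact S := by
    refine IsCompact.of_isClosed_subset
      ((isCompact_Icc (a := -√B) (b := √B)).prod (isCompact_Icc (a := -√B) (b := √B))) hSc ?_
    rintro ⟨p, q⟩ h
    simp only [hS, mem_ofPred_eq] at h
    simp only [mem_prod, mem_Icc]
    rw [← abs_le, ← abs_le]
    exact ⟨Real.abs_le_sqrt (by nlinarith [sq_nonneg q]), Real.abs_le_sqrt (by nlinarith [sq_nonneg p])⟩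
  have hGS : (fun p : ℝ × ℝ => G (p.1 ^ 2 + p.2 ^ 2)) =
      S.indicator (fun p => H (x + (p.1 ^ 2 + p.2 ^ 2))) := by
    funext p
    simp only [hG, hS, indicator, mem_ofPred_eq]
  have hint : Integrable (fun p : ℝ × ℝ => G (p.1 ^ 2 + p.2 ^ 2)) := by
    rw [hGS, integrable_indicator_iff hSc.measurableSet]
    exact ContinuousOn.integrableOn_compact hcomp (by fun_prop)
  have h0 : ∫ p : ℝ × ℝ, G (p.1 ^ 2 + p.2 ^ 2) = 0 := by
    rw [Measure.volume_eq_prod, integral_prod _ (by rwa [← Measure.volume_eq_prod])]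
    have : ∀ σ : ℝ, ∫ τ : ℝ, G (σ ^ 2 + τ ^ 2) = 0 := by
      intro σ
      by_cases hσ : σ ^ 2 ≤ B
      · have e1 : (fun τ : ℝ => G (σ ^ 2 + τ ^ 2)) =
            (Icc (-√(B - σ ^ 2)) (√(B - σ ^ 2))).indicator (fun τ => H (x + σ ^ 2 + τ ^ 2)) := by
          funext τ
          simp only [hG, indicator, mem_Icc]
          have : σ ^ 2 + τ ^ 2 ≤ B ↔ (-√(B - σ ^ 2) ≤ τ ∧ τ ≤ √(B - σ ^ 2)) := by
            rw [← abs_le, ← Real.sqrt_sq_eq_abs, Real.sqrt_le_sqrt_iff (by linarith)]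
            constructor <;> intro h <;> linarith
          simp only [this, add_assoc]
        rw [e1, integral_indicator measurableSet_Icc, integral_Icc_eq_integral_Ioc,
          ← intervalIntegral.integral_of_le (by linarith [Real.sqrt_nonneg (B - σ ^ 2)])]
        have hc : Continuous (fun τ : ℝ => H (x + σ ^ 2 + τ ^ 2)) := by fun_prop
        rw [← intervalIntegral.integral_add_adjacent_intervals (b := 0)
          (hc.intervalIntegrable _ _) (hc.intervalIntegrable _ _), hF σ hσ]
        have := intervalIntegral.integral_comp_neg (a := 0) (b := √(B - σ ^ 2))
          (fun τ : ℝ => H (x + σ ^ 2 + τ ^ 2))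
        simp only [neg_zero, neg_sq] at this
        rw [← this, hF σ hσ, add_zero]
      · have : ∀ τ : ℝ, G (σ ^ 2 + τ ^ 2) = 0 := by
          intro τ
          simp only [hG]
          rw [if_neg]
          nlinarith [sq_nonneg τ]
        simp [this]
    simp [this]
  rw [← integral_comp_polarCoord_symm] at h0
  have e2 : ∀ p : ℝ × ℝ, p.1 • G ((polarCoord.symm p).1 ^ 2 + (polarCoord.symm p).2 ^ 2)
      = (p.1 * G (p.1 ^ 2)) * (fun _ : ℝ => (1:ℝ)) p.2 := by
    intro p
    simp only [polarCoord_symm_apply, smul_eq_mul, mul_one]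
    congr 2
    nlinarith [Real.sin_sq_add_cos_sq p.2]
  simp only [e2] at h0
  rw [polarCoord_target, Measure.volume_eq_prod,
    setIntegral_prod_mul (fun t : ℝ => t * G (t ^ 2)) (fun _ : ℝ => (1:ℝ))] at h0
  have h1 : ∫ t in Ioi (0:ℝ), t * G (t ^ 2) = 0 := by
    rcases mul_eq_zero.1 h0 with h | h
    · exact h
    · exfalso
      simp at h
      have := Real.pi_pos
      first
        | linarith
        | (rw [max_eq_left] at h <;> linarith)
  have h2 : ∫ t in (0:ℝ)..√B, t * H (x + t ^ 2) = 0 := by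
    rw [intervalIntegral.integral_of_le (Real.sqrt_nonneg _)]
    refine Eq.trans ?_ h1
    rw [← integral_indicator measurableSet_Ioc, ← integral_indicator measurableSet_Ioi]
    congr 1
    funext t
    simp only [indicator, mem_Ioc, mem_Ioi, hG]
    by_cases ht : 0 < t
    · have : t ^ 2 ≤ B ↔ t ≤ √B := (Real.le_sqrt ht.le hB.le).symm
      simp only [ht, this, true_and, if_true, mul_ite, mul_zero]
    · simp [ht]
  have h3 := intervalIntegral.integral_comp_mul_deriv (a := 0) (b := √B)
    (f := fun t : ℝ => x + t ^ 2) (f' := fun t => 2 * t) (g := H)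
    (fun t _ => by simpa using (hasDerivAt_pow 2 t).const_add x) (by fun_prop) hH
  have e3 : ∀ t : ℝ, (H ∘ fun t : ℝ => x + t ^ 2) t * (2 * t) = 2 * (t * H (x + t ^ 2)) := by
    intro t; simp only [Function.comp]; ring
  simp only [e3, intervalIntegral.integral_const_mul, h2, Real.sq_sqrt hB.le] at h3
  simpa using h3.symm

lemma aux_abel (H : ℝ → ℝ) (hH : Continuous H) (α b : ℝ)
    (hF : ∀ x ∈ Ioo α b, ∫ τ in (0:ℝ)..√(b - x), H (x + τ ^ 2) = 0) :
    ∀ x ∈ Ioo α b, H x = 0 := by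
  have key : ∀ x ∈ Ioo α b, ∫ y in x..b, H y = 0 := by
    intro x hx
    have := aux_abel_plane H hH x (b - x) (by linarith [hx.2]) ?_
    · simpa using this
    · intro σ hσ
      rcases hσ.lt_or_eq with h | h
      · have := hF (x + σ ^ 2) ⟨by nlinarith [hx.1, sq_nonneg σ], by linarith⟩
        rwa [show b - (x + σ ^ 2) = b - x - σ ^ 2 by ring] at this
      · simp [h]
  intro x hx
  have hd := intervalIntegral.integral_hasDerivAt_left (hH.intervalIntegrable x b)
    (hH.stronglyMeasurableAtFilter _ _) hH.continuousAt
  have h0 : (fun u => ∫ y in u..b, H y) =ᶠ[𝓝 x] fun _ => 0 := by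
    filter_upwards [isOpen_Ioo.mem_nhds hx] with y hy using key y hy
  have := (hd.congr_of_eventuallyEq h0.symm).unique (hasDerivAt_const x (0:ℝ))
  linarith

lemma aux_repr (R : ℝ) (hR0 : 0 ≤ R) (hR1 : R < 1) (c : ℝ → ℝ)
    (hpos : ∀ r ∈ Icc R 1, 0 < c r)
    (hC11 : IsC11On c R) (hHerg : HerglotzCond c R) :
    ∃ u : ℝ → ℝ, ContinuousOn u (Icc R 1) ∧ StrictMonoOn u (Icc R 1) ∧
      ∀ f : ℝ → ℝ, ContinuousOn f (Icc R 1) → ∀ a ∈ Ioo R 1,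
        ∃ H : ℝ → ℝ, Continuous H ∧ (∀ s ∈ Icc a 1, H (u s) = 0 → f s = 0) ∧
          ∀ r ∈ Ico a 1, Afun c f r = ∫ τ in (0:ℝ)..√(u 1 - u r), 2 * H (u r + τ ^ 2) := by
  obtain ⟨c', K, hc, hK⟩ := hC11
  have hc'c : ContinuousOn c' (Icc R 1) := hK.continuousOn
  have hcc : ContinuousOn c (Icc R 1) := fun r hr => (hc r hr).continuousWithinAt
  set ρ : ℝ → ℝ := fun s => s / c s with hρ
  set ρ' : ℝ → ℝ := fun s => (1 * c s - s * c' s) / c s ^ 2 with hρ'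
  have hd : ∀ s ∈ Icc R 1, HasDerivWithinAt ρ (ρ' s) (Icc R 1) s := fun s hs =>
    (hasDerivWithinAt_id s _).div (hc s hs) (hpos s hs).ne'
  have hρ'pos : ∀ s ∈ Icc R 1, 0 < ρ' s := by
    intro s hs
    have := hHerg s hs
    rwa [(hd s hs).derivWithin (uniqueDiffOn_Icc hR1 s hs)] at this
  have hρc : ContinuousOn ρ (Icc R 1) := fun r hr => (hd r hr).continuousWithinAt
  have hρ'c : ContinuousOn ρ' (Icc R 1) := by
    refine ContinuousOn.div (by fun_prop) (by fun_prop) ?_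
    intro s hs
    exact pow_ne_zero _ (hpos s hs).ne'
  have hdA : ∀ s ∈ Ioo R 1, HasDerivAt ρ (ρ' s) s := fun s hs =>
    (hd s (Ioo_subset_Icc_self hs)).hasDerivAt (Icc_mem_nhds hs.1 hs.2)
  have hρm : StrictMonoOn ρ (Icc R 1) := by
    refine strictMonoOn_of_deriv_pos (convex_Icc _ _) hρc ?_
    intro s hs
    rw [interior_Icc] at hs
    rw [(hdA s hs).deriv]
    exact hρ'pos s (Ioo_subset_Icc_self hs)
  have hρ0 : ∀ s ∈ Icc R 1, 0 ≤ ρ s := fun s hs =>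
    div_nonneg (hR0.trans hs.1) (hpos s hs).le
  have hum : StrictMonoOn (fun s => ρ s ^ 2) (Icc R 1) := by
    intro s hs t ht hst
    exact pow_lt_pow_left₀ (hρm hs ht hst) (hρ0 s hs) two_ne_zero
  refine ⟨fun s => ρ s ^ 2, by fun_prop, hum, ?_⟩
  intro f hf a ha
  have hsub : Icc a 1 ⊆ Icc R 1 := Icc_subset_Icc_left ha.1.le
  have hρpos : ∀ s ∈ Icc a 1, 0 < ρ s := fun s hs =>
    div_pos (hR0.trans_lt (ha.1.trans_le hs.1)) (hpos s (hsub hs))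
  have hkc : ContinuousOn (fun s => f s / c s * ρ s / (2 * ρ s * ρ' s)) (Icc a 1) := by
    have h1 := hf.mono hsub
    have h2 := hcc.mono hsub
    have h3 := hρc.mono hsub
    have h4 := hρ'c.mono hsub
    refine ContinuousOn.div (ContinuousOn.mul (h1.div h2 ?_) h3) (by fun_prop) ?_
    · intro s hs
      exact (hpos s (hsub hs)).ne'
    · intro s hs
      have := hρpos s hs
      have := hρ'pos s (hsub hs)
      positivity
  have hemb : IsClosedEmbedding ((Icc a 1).restrict (fun s => ρ s ^ 2)) := by
    refine Continuous.isClosedEmbedding ?_ ?_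
    · exact ((hρc.mono hsub).pow 2).restrict
    · exact ((hum.mono hsub).injOn).injective
  obtain ⟨H, hH⟩ := ContinuousMap.exists_extension hemb ⟨_, hkc.restrict⟩
  have hHk : ∀ s ∈ Icc a 1, H (ρ s ^ 2) = f s / c s * ρ s / (2 * ρ s * ρ' s) := fun s hs =>
    DFunLike.congr_fun hH ⟨s, hs⟩
  refine ⟨H, H.continuous, ?_, ?_⟩
  · intro s hs h
    rw [hHk s hs] at h
    have h1 := hρpos s hs
    have h2 := hρ'pos s (hsub hs)
    have h3 := hpos s (hsub hs)
    have h4 : 2 * ρ s * ρ' s ≠ 0 := by positivity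
    rcases div_eq_zero_iff.1 h with h | h
    · rcases mul_eq_zero.1 h with h | h
      · rcases div_eq_zero_iff.1 h with h | h
        · exact h
        · exact absurd h h3.ne'
      · exact absurd h h1.ne'
    · exact absurd h h4
  · intro r hr
    have hrI : r ∈ Icc R 1 := ⟨ha.1.le.trans hr.1, hr.2.le⟩
    have hsubr : Icc r 1 ⊆ Icc R 1 := Icc_subset_Icc_left hrI.1
    set ψ : ℝ → ℝ := fun s => √(ρ s ^ 2 - ρ r ^ 2) with hψ
    have hdiff : ∀ s ∈ Ioc r 1, 0 < ρ s ^ 2 - ρ r ^ 2 := fun s hs =>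
      sub_pos.2 (hum hrI (hsubr ⟨hs.1.le, hs.2⟩) hs.1)
    have hψd : ∀ s ∈ Ioo r 1,
        HasDerivWithinAt ψ (2 * ρ s * ρ' s / (2 * ψ s)) (Ioo r 1) s := by
      intro s hs
      have h := ((hdA s ⟨hrI.1.trans_lt hs.1, hs.2⟩).pow 2).sub_const (ρ r ^ 2)
      have h' := (h.sqrt (hdiff s ⟨hs.1, hs.2.le⟩).ne').hasDerivWithinAt (s := Ioo r 1)
      simpa using h'
    have hψm : StrictMonoOn ψ (Icc r 1) := by
      intro s hs t ht hst
      refine Real.sqrt_lt_sqrt ?_ ?_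
      · exact sub_nonneg.2 (hum.monotoneOn hrI (hsubr hs) hs.1)
      · exact sub_lt_sub_right (hum (hsubr hs) (hsubr ht) hst) _
    have hψc : ContinuousOn ψ (Icc r 1) :=
      (((hρc.mono hsubr).pow 2).sub continuousOn_const).sqrt
    have hψr : ψ r = 0 := by simp [hψ]
    have himg : ψ '' Ioo r 1 = Ioo 0 (ψ 1) := by
      apply Subset.antisymm
      · rintro _ ⟨s, hs, rfl⟩
        have hs' := Ioo_subset_Icc_self hs
        rw [← hψr]
        exact ⟨hψm ⟨le_rfl, hr.2.le⟩ hs' hs.1, hψm hs' ⟨hr.2.le, le_rfl⟩ hs.2⟩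
      · have := intermediate_value_Ioo hr.2.le hψc
        rwa [hψr] at this
    have hcv := integral_image_eq_integral_abs_deriv_smul measurableSet_Ioo hψd
      (hψm.mono Ioo_subset_Icc_self).injOn (fun τ => 2 * H (ρ r ^ 2 + τ ^ 2))
    rw [himg] at hcv
    rw [intervalIntegral.integral_of_le (Real.sqrt_nonneg _), integral_Ioc_eq_integral_Ioo]
    change _ = ∫ τ in Ioo 0 (ψ 1), 2 * H (ρ r ^ 2 + τ ^ 2)
    rw [hcv, Afun, intervalIntegral.integral_of_le hr.2.le, integral_Ioc_eq_integral_Ioo]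
    refine setIntegral_congr_fun measurableSet_Ioo ?_
    intro s hs
    have hsa : s ∈ Icc a 1 := ⟨hr.1.trans hs.1.le, hs.2.le⟩
    have p1 := hρpos s hsa
    have p2 := hρ'pos s (hsub hsa)
    have p3 := hpos s (hsub hsa)
    have p4 := hpos r hrI
    have p5 := hdiff s ⟨hs.1, hs.2.le⟩
    have p6 : 0 < ψ s := Real.sqrt_pos.2 p5
    have p7 : 0 < s := hR0.trans_lt (ha.1.trans_le hsa.1)
    have e1 : ρ r ^ 2 + ψ s ^ 2 = ρ s ^ 2 := by
      rw [hψ]; simp only []; rw [Real.sq_sqrt p5.le]; ring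
    have e2 : √(1 - (r * c s / (s * c r)) ^ 2) = ψ s / ρ s := by
      rw [show 1 - (r * c s / (s * c r)) ^ 2 = (ρ s ^ 2 - ρ r ^ 2) / ρ s ^ 2 by
        simp only [hρ]; field_simp]
      rw [Real.sqrt_div p5.le, Real.sqrt_sq p1.le]
    simp only [smul_eq_mul]
    rw [e1, e2, hHk s hsa, abs_of_pos (by positivity)]
    generalize ρ s = A at *
    generalize ρ' s = B at *
    generalize ψ s = D at *
    field_simp

theorem stmt9 (R : ℝ) (hR0 : 0 ≤ R) (hR1 : R < 1) (c : ℝ → ℝ)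
    (hpos : ∀ r ∈ Set.Icc R 1, 0 < c r)
    (hC11 : IsC11On c R) (hHerg : HerglotzCond c R) :
    (∀ f : ℝ → ℝ, ContinuousOn f (Set.Icc R 1) →
      ContinuousOn (Afun c f) (Set.Ioo R 1)) ∧
    (∀ f : ℝ → ℝ, ContinuousOn f (Set.Icc R 1) →
      (∀ r ∈ Set.Ioo R 1, Afun c f r = 0) → ∀ r ∈ Set.Icc R 1, f r = 0) := by
  obtain ⟨u, huc, hum, hrep⟩ := aux_repr R hR0 hR1 c hpos hC11 hHerg
  refine ⟨?_, ?_⟩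
  · intro f hf r hr
    have ha : (R + r) / 2 ∈ Ioo R 1 := ⟨by linarith [hr.1], by linarith [hr.1, hr.2]⟩
    obtain ⟨H, hH, -, hA⟩ := hrep f hf _ ha
    have hF : Continuous (fun x : ℝ => ∫ τ in (0:ℝ)..√(u 1 - x), 2 * H (x + τ ^ 2)) :=
      intervalIntegral.continuous_parametric_intervalIntegral_of_continuous
        (f := fun x τ => 2 * H (x + τ ^ 2)) (by fun_prop) (by fun_prop)
    have hu : ContinuousAt u r := huc.continuousAt (Icc_mem_nhds hr.1 hr.2)
    have h := ContinuousAt.comp (f := u) (x := r) hF.continuousAt hu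
    refine ContinuousAt.continuousWithinAt (h.congr ?_)
    filter_upwards [Ioo_mem_nhds (show (R + r) / 2 < r by linarith [hr.1]) hr.2] with t ht
    exact (hA t ⟨ht.1.le, ht.2⟩).symm
  · intro f hf h0
    have hz : ∀ s ∈ Ioo R 1, f s = 0 := by
      intro s hs
      have ha : (R + s) / 2 ∈ Ioo R 1 := ⟨by linarith [hs.1], by linarith [hs.1, hs.2]⟩
      have has : (R + s) / 2 < s := by linarith [hs.1]
      obtain ⟨H, hH, hHf, hA⟩ := hrep f hf _ ha
      have haI := Ioo_subset_Icc_self ha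
      have h1I : (1:ℝ) ∈ Icc R 1 := ⟨hR1.le, le_rfl⟩
      apply hHf s ⟨has.le, hs.2.le⟩
      refine aux_abel H hH (u ((R + s) / 2)) (u 1) ?_ (u s)
        ⟨hum haI (Ioo_subset_Icc_self hs) has, hum (Ioo_subset_Icc_self hs) h1I hs.2⟩
      intro x hx
      obtain ⟨r, hr, rfl⟩ := intermediate_value_Ioo ha.2.le
        (huc.mono (Icc_subset_Icc_left ha.1.le)) hx
      have h1 := hA r ⟨hr.1.le, hr.2⟩
      rw [h0 r ⟨ha.1.trans hr.1, hr.2⟩, intervalIntegral.integral_const_mul] at h1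
      linarith
    intro r hr
    have hcl : closure (Ioo R 1) = Icc R 1 := closure_Ioo hR1.ne
    have := Set.EqOn.of_subset_closure (s := Ioo R 1) (t := Icc R 1) (f := f)
      (g := fun _ => (0:ℝ)) (fun s hs => hz s hs) hf continuousOn_const
      Ioo_subset_Icc_self hcl.symm.subset
    exact this hr
end
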